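/- Let p ≥ 1 and let σ₁ ≥ σ₂ ≥ … ≥ σ_{2p} be real numbers. Then the following two subsets of ℝ^p coincide: (1) the set of p-tuples ((γ̂₁+γ̂₂)/2, (γ̂₃+γ̂₄)/2, …, (γ̂_{2p−1}+γ̂_{2p})/2), where (γ̂₁ ≥ γ̂₂ ≥ … ≥ γ̂_{2p}) ranges over the ordered spectra of sums A + B of real symmetric 2p×2p matrices A, B each having ordered spectrum (σ₁, …, σ_{2p}) (i.e. the orthogonal projection of the Horn polytope 𝒫 onto the diagonal Δ, identified with ℝ^p); (2) the set 𝒫₁ of ordered spectra of sums a + b of real symmetric p×p matrices a, b with ordered spectra (σ₁, σ₃, …, σ_{2p−1}) and (σ₂, σ₄, …, σ_{2p}) respectively. -/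

import Mathlib

open Matrix

section Dominance

open MvPolynomial

/-- A constructible subset of the spectrum of a domain containing the generic point contains a
nonempty basic open set. -/
lemma exists_basicOpen_subset_of_isConstructible {R : Type*} [CommRing R] [IsDomain R]
    {s : Set (PrimeSpectrum R)} (hs : Topology.IsConstructible s)
    (h : (⟨⊥, Ideal.isPrime_bot⟩ : PrimeSpectrum R) ∈ s) :
    ∃ f : R, f ≠ 0 ∧ ∀ P : PrimeSpectrum R, f ∉ P.asIdeal → P ∈ s := by
  obtain ⟨S, rfl⟩ := PrimeSpectrum.exists_constructibleSetData_iff.mpr hs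
  simp only [PrimeSpectrum.ConstructibleSetData.toSet, Set.mem_iUnion] at h
  obtain ⟨D, hD, hg, hf⟩ := h
  refine ⟨D.f, ?_, fun P hP => ?_⟩
  · rintro h0
    apply hf
    simp [h0]
  · simp only [PrimeSpectrum.ConstructibleSetData.toSet, Set.mem_iUnion]
    refine ⟨D, hD, ?_, ?_⟩
    · rw [PrimeSpectrum.mem_zeroLocus] at hg ⊢
      intro x hx
      have : x = 0 := by simpa using hg hx
      simp [this]
    · simpa [PrimeSpectrum.mem_zeroLocus] using hP

/-- A complex polynomial vanishing on a nonempty open set is zero. -/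
lemma MvPolynomial.eq_zero_of_vanish_on_open {κ : Type*} [Finite κ] (P : MvPolynomial κ ℂ)
    {s : Set (κ → ℂ)} (hs : IsOpen s) (hne : s.Nonempty) (h : ∀ y ∈ s, eval y P = 0) : P = 0 := by
  have := Fintype.ofFinite κ
  obtain ⟨y, hy⟩ := hne
  obtain ⟨ε, hε, hb⟩ := Metric.isOpen_iff.mp hs y hy
  refine funext_set (fun k => Metric.ball (y k) ε) (fun k => ?_) fun x hx => ?_
  · exact infinite_of_mem_nhds (y k) (Metric.ball_mem_nhds _ hε)
  · rw [map_zero]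
    refine h x (hb ?_)
    rw [ball_pi _ hε]
    exact hx

/-- If the image of a polynomial map between complex affine spaces has an interior point, then
it is dense. -/
theorem dense_range_of_nonempty_interior {τ κ : Type*} [Finite τ] [Finite κ]
    (q : κ → MvPolynomial τ ℂ)
    (h : (interior (Set.range fun (x : τ → ℂ) k => eval x (q k))).Nonempty) :
    Dense (Set.range fun (x : τ → ℂ) k => eval x (q k)) := by
  set Ψ : (τ → ℂ) → κ → ℂ := fun x k => eval x (q k) with hΨ
  set φ : MvPolynomial κ ℂ →ₐ[ℂ] MvPolynomial τ ℂ := aeval q with hφ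
  have hev : ∀ x P, eval x (φ P) = eval (Ψ x) P := by
    intro x P
    rw [hφ, aeval_def, ← eval₂_id (g := x) (eval₂ _ _ _)]
    simp only [eval₂_id]
    rw [show eval x (eval₂ (algebraMap ℂ (MvPolynomial τ ℂ)) q P) = _ from
      eval₂_comp_left (eval x) _ _ _]
    simp only [hΨ]
    rw [eval, coe_eval₂Hom]
    congr 1
    ext; simp
  have hinj : Function.Injective φ := by
    rw [injective_iff_map_eq_zero]
    intro P hP
    refine P.eq_zero_of_vanish_on_open isOpen_interior h fun y hy => ?_
    obtain ⟨x, rfl⟩ := interior_subset hy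
    have := hev x P
    rw [hP, map_zero] at this
    exact this.symm
  have hfp : φ.toRingHom.FinitePresentation := by
    refine RingHom.FinitePresentation.of_comp_finiteType (algebraMap ℂ (MvPolynomial κ ℂ)) ?_ ?_
    · rw [show φ.toRingHom.comp (algebraMap ℂ (MvPolynomial κ ℂ)) = algebraMap ℂ _ from
        φ.comp_algebraMap]
      exact RingHom.finitePresentation_algebraMap.mpr inferInstance
    · exact RingHom.finiteType_algebraMap.mpr inferInstance
  obtain ⟨f, hf0, hf⟩ := exists_basicOpen_subset_of_isConstructible
    (PrimeSpectrum.isConstructible_range_comap hfp) ⟨⟨⊥, Ideal.isPrime_bot⟩, by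
      ext P
      simp only [PrimeSpectrum.comap_asIdeal, Ideal.mem_comap, Ideal.mem_bot]
      exact map_eq_zero_iff φ hinj⟩
  have hsub : {y | eval y f ≠ 0} ⊆ Set.range Ψ := by
    intro y hy
    obtain ⟨Q, hQ⟩ := hf ⟨vanishingIdeal ℂ {y}, inferInstance⟩ (by
      simpa [aeval_eq_eval] using hy)
    obtain ⟨N, hN, hQN⟩ := Ideal.exists_le_maximal Q.asIdeal Q.isPrime.ne_top
    obtain ⟨x, hx⟩ := isMaximal_iff_eq_vanishingIdeal_singleton.mp hN
    refine ⟨x, funext fun k => ?_⟩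
    have h1 : (X k - C (y k) : MvPolynomial κ ℂ) ∈ vanishingIdeal ℂ {y} := by
      simp
    have h2 : φ (X k - C (y k)) ∈ N := by
      apply hQN
      have := congrArg PrimeSpectrum.asIdeal hQ
      simp only [PrimeSpectrum.comap_asIdeal] at this
      rw [← this] at h1
      exact h1
    rw [hx, mem_vanishingIdeal_singleton_iff] at h2
    have h3 : eval x (φ (X k - C (y k))) = 0 := by simpa [aeval_eq_eval] using h2
    rw [hev] at h3
    simpa [sub_eq_zero] using h3
  refine Dense.mono hsub ?_
  rw [dense_iff_inter_open]
  intro U hU hne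
  by_contra hcon
  refine hf0 (f.eq_zero_of_vanish_on_open hU hne fun y hy => ?_)
  by_contra h0
  exact hcon ⟨y, hy, h0⟩

end Dominance

section FlagParam

variable {N ι R S : Type*} [Fintype N] [LinearOrder N] [CommRing R] [CommRing S]

/-- Coordinates for triples consisting of a matrix and two families of matrices. -/
abbrev FlagCoord (N ι : Type*) : Type _ := (N × N) ⊕ (ι × N × N) ⊕ (ι × N × N)

/-- The family `g * H s * π s * u s`, where `π s` ranges over the matrices that preserve the
coordinate subspace spanned by `F s` and `u s` over the upper triangular matrices. -/
def flagParam (H : ι → Matrix N N R) (F : ι → Finset N) (x : FlagCoord N ι → R) (s : ι) :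
    Matrix N N R :=
  (Matrix.of fun a b => x (Sum.inl (a, b))) * H s *
    (Matrix.of fun j i => if i ∈ F s ∧ j ∉ F s then 0 else x (Sum.inr (Sum.inl (s, j, i)))) *
    (Matrix.of fun j i => if i < j then 0 else x (Sum.inr (Sum.inr (s, j, i))))

lemma flagParam_map (f : R →+* S) (H : ι → Matrix N N R) (F : ι → Finset N)
    (x : FlagCoord N ι → R) (s : ι) :
    (flagParam H F x s).map f = flagParam (fun s => (H s).map f) F (f ∘ x) s := by
  simp only [flagParam, Matrix.map_mul]
  congr 2
  · ext j i; simp only [map_apply, of_apply, Function.comp]; split_ifs <;> simp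
  · ext j i; simp only [map_apply, of_apply, Function.comp]; split_ifs <;> simp

/-- The coordinates of a matrix and two families of matrices. -/
def flagCoords (G : Matrix N N R) (P Q : ι → Matrix N N R) : FlagCoord N ι → R :=
  Sum.elim (fun a => G a.1 a.2) (Sum.elim (fun a => P a.1 a.2.1 a.2.2) fun a => Q a.1 a.2.1 a.2.2)

lemma flagParam_flagCoords (H : ι → Matrix N N R) (F : ι → Finset N)
    (G : Matrix N N R) (P Q : ι → Matrix N N R)
    (hP : ∀ s i j, i ∈ F s → j ∉ F s → P s j i = 0) (hQ : ∀ s i j, i < j → Q s j i = 0) (s : ι) :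
    flagParam H F (flagCoords G P Q) s = G * H s * P s * Q s := by
  simp only [flagParam, flagCoords, Sum.elim_inl, Sum.elim_inr]
  congr 2
  · ext j i; simp only [of_apply]; split_ifs with h
    · exact (hP s i j h.1 h.2).symm
    · rfl
  · ext j i; simp only [of_apply]; split_ifs with h
    · exact (hQ s i j h).symm
    · rfl

lemma flagParam_line (H : ι → Matrix N N R) (F : ι → Finset N)
    (G : Matrix N N R) (P Q : ι → Matrix N N R)
    (hP : ∀ s i j, i ∈ F s → j ∉ F s → P s j i = 0) (hQ : ∀ s i j, i < j → Q s j i = 0)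
    (t : R) (s : ι) :
    flagParam H F (flagCoords 1 1 1 + t • flagCoords G P Q) s =
      H s + t • (G * H s + H s * P s + H s * Q s) +
        t ^ 2 • (G * H s * P s + G * H s * Q s + H s * P s * Q s) +
        t ^ 3 • (G * H s * P s * Q s) := by
  have : flagCoords (1 : Matrix N N R) (1 : ι → Matrix N N R) 1 + t • flagCoords G P Q =
      flagCoords (1 + t • G) (fun s => 1 + t • P s) (fun s => 1 + t • Q s) := by
    funext x
    rcases x with x | x | x <;> simp [flagCoords]
  rw [this, flagParam_flagCoords]
  · simp only [add_mul, mul_add, one_mul, mul_one, smul_mul_assoc, mul_smul_comm, smul_add,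
      smul_smul, pow_succ, pow_zero, mul_assoc]
    abel
  · intro s i j hi hj
    have : j ≠ i := by rintro rfl; exact hj hi
    simp [hP s i j hi hj, this]
  · intro s i j hij
    simp [hQ s i j hij, hij.ne']

end FlagParam

section Open

variable {N ι : Type*} [Fintype N] [LinearOrder N] [Finite ι]

theorem dense_range_flagParam (H : ι → Matrix N N ℂ) (F : ι → Finset N)
    (hH : ∀ s, (H s)ᵀ * H s = 1)
    (hsurj : ∀ Y : ι → Matrix N N ℂ, ∃ Φ : Matrix N N ℂ, ∀ s, ∀ i ∈ F s, ∀ j ∉ F s, i < j →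
      ((H s)ᵀ * (Y s - Φ) * H s) j i = 0) :
    Dense (Set.range fun (x : FlagCoord N ι → ℂ) (k : ι × N × N) =>
      flagParam H F x k.1 k.2.1 k.2.2) := by
  have := Fintype.ofFinite ι
  let q : ι × N × N → MvPolynomial (FlagCoord N ι) ℂ := fun k =>
    flagParam (fun s => (H s).map (MvPolynomial.C (σ := FlagCoord N ι))) F MvPolynomial.X
      k.1 k.2.1 k.2.2
  have hq : (fun (x : FlagCoord N ι → ℂ) (k : ι × N × N) => flagParam H F x k.1 k.2.1 k.2.2) =
      fun x k => MvPolynomial.eval x (q k) := by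
    funext x k
    have := congrFun (congrFun (flagParam_map (MvPolynomial.eval x)
      (fun s => (H s).map (MvPolynomial.C (σ := FlagCoord N ι))) F MvPolynomial.X k.1) k.2.1) k.2.2
    simp only [map_apply] at this
    simp only [q, this]
    congr 1
    · funext s; ext; simp
    · funext s; simp
  rw [hq]
  apply dense_range_of_nonempty_interior
  set Ψ : (FlagCoord N ι → ℂ) → (ι × N × N) → ℂ := fun x k => MvPolynomial.eval x (q k) with hΨ
  set x₀ : FlagCoord N ι → ℂ := flagCoords 1 1 1
  have hdiff : ContDiffAt ℂ 1 Ψ x₀ := by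
    rw [contDiffAt_pi]
    intro k
    exact (AnalyticOnNhd.eval_mvPolynomial (𝕜 := ℂ) (q k) x₀ (Set.mem_univ _)).contDiffAt
  have hstrict := hdiff.hasStrictFDerivAt one_ne_zero
  have hrange : (fderiv ℂ Ψ x₀).range = ⊤ := by
    rw [LinearMap.range_eq_top]
    intro y
    obtain ⟨Φ, hΦ⟩ := hsurj fun s => (Matrix.of fun a b => y (s, a, b)) * (H s)ᵀ
    set R : ι → Matrix N N ℂ := fun s =>
      (H s)ᵀ * ((Matrix.of fun a b => y (s, a, b)) * (H s)ᵀ - Φ) * H s with hR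
    set P : ι → Matrix N N ℂ := fun s => Matrix.of fun j i =>
      if i ∈ F s ∧ j ∉ F s then 0 else R s j i with hPdef
    set Q : ι → Matrix N N ℂ := fun s => R s - P s with hQdef
    have hP : ∀ s i j, i ∈ F s → j ∉ F s → P s j i = 0 := by
      intro s i j hi hj
      simp [hPdef, hi, hj]
    have hQ : ∀ s i j, i < j → Q s j i = 0 := by
      intro s i j hij
      by_cases h : i ∈ F s ∧ j ∉ F s
      · have := hΦ s i h.1 j h.2 hij
        simp [hQdef, hP s i j h.1 h.2, hR, this]
      · simp only [hQdef, hPdef]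
        rw [Matrix.sub_apply, of_apply, if_neg h, sub_self]
    have hsum : ∀ s, Φ * H s + H s * P s + H s * Q s = Matrix.of fun a b => y (s, a, b) := by
      intro s
      have h1 : H s * (H s)ᵀ = 1 := mul_eq_one_comm.mp (hH s)
      have h2 : H s * P s + H s * Q s = H s * R s := by
        rw [← mul_add, hQdef, add_sub_cancel]
      rw [add_assoc, h2, hR]
      simp only [← mul_assoc, h1, one_mul, sub_mul, mul_sub]
      rw [mul_assoc _ ((H s)ᵀ) (H s), hH s, mul_one]
      abel
    refine ⟨flagCoords Φ P Q, ?_⟩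
    have hd : HasDerivAt (fun t : ℂ => Ψ (x₀ + t • flagCoords Φ P Q))
        (fderiv ℂ Ψ x₀ (flagCoords Φ P Q)) 0 := by
      have hl : HasDerivAt (fun t : ℂ => x₀ + t • flagCoords Φ P Q) (flagCoords Φ P Q) 0 := by
        simpa using ((hasDerivAt_id (0 : ℂ)).smul_const (flagCoords Φ P Q)).const_add x₀
      have hf : HasFDerivAt Ψ (fderiv ℂ Ψ x₀) (x₀ + (0 : ℂ) • flagCoords Φ P Q) := by
        simpa using hstrict.hasFDerivAt
      exact hf.comp_hasDerivAt (0 : ℂ) hl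
    refine hd.unique ?_
    rw [hasDerivAt_pi]
    rintro ⟨s, a, b⟩
    have hval : ∀ t : ℂ, Ψ (x₀ + t • flagCoords Φ P Q) (s, a, b) =
        H s a b + t * y (s, a, b) +
        t ^ 2 * ((Φ * H s * P s + Φ * H s * Q s + H s * P s * Q s) a b) +
        t ^ 3 * ((Φ * H s * P s * Q s) a b) := by
      intro t
      have := congrFun (congrFun hq (x₀ + t • flagCoords Φ P Q)) (s, a, b)
      refine this.symm.trans ?_
      dsimp only
      rw [flagParam_line H F Φ P Q hP hQ, hsum]
      simp [mul_add]
    rw [show (fun t : ℂ => Ψ (x₀ + t • flagCoords Φ P Q) (s, a, b)) = _ from funext hval]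
    have := ((((hasDerivAt_id (0 : ℂ)).mul_const (y (s, a, b))).const_add (H s a b)).add
      (((hasDerivAt_id (0 : ℂ)).pow 2).mul_const
        ((Φ * H s * P s + Φ * H s * Q s + H s * P s * Q s) a b))).add
      (((hasDerivAt_id (0 : ℂ)).pow 3).mul_const ((Φ * H s * P s * Q s) a b))
    refine this.congr_deriv ?_
    simp
  have hmap := hstrict.map_nhds_eq_of_surj hrange
  refine ⟨Ψ x₀, mem_interior_iff_mem_nhds.mpr ?_⟩
  rw [← hmap]
  exact Filter.range_mem_map

end Open

section Compression

open Submodule in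
/-- If a quadratic form is bounded below by `c i` on the `i`-th step of a full flag of `V`,
then the trace of its compression to `V` is at least `∑ i, c i`. -/
lemma sum_le_trace_compression {E κ : Type*} [NormedAddCommGroup E] [InnerProductSpace ℂ E]
    [FiniteDimensional ℂ E] [Fintype κ] [LinearOrder κ] (V : Submodule ℂ E)
    (hcard : Module.finrank ℂ V = Fintype.card κ) (f : κ → E) (hf : LinearIndependent ℂ f)
    (hV : ∀ i, f i ∈ V) (T : E →ₗ[ℂ] E) (c : κ → ℝ)
    (hc : ∀ i, ∀ x ∈ span ℂ (f '' Set.Iic i), c i * ‖x‖ ^ 2 ≤ (inner ℂ x (T x)).re) :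
    ∑ i, c i ≤ (LinearMap.trace ℂ V
      (V.orthogonalProjectionOnto.toLinearMap ∘ₗ T ∘ₗ V.subtype)).re := by
  let _ : LocallyFiniteOrder κ := Fintype.toLocallyFiniteOrder
  let _ : LocallyFiniteOrderBot κ :=
    LocallyFiniteOrderBot.ofIic' κ (fun a => Finset.univ.filter (· ≤ a)) (by simp)
  let f' : κ → V := fun i => ⟨f i, hV i⟩
  have hf' : LinearIndependent ℂ f' := by
    apply LinearIndependent.of_comp V.subtype
    exact hf
  set b := InnerProductSpace.gramSchmidtOrthonormalBasis hcard f' with hb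
  rw [LinearMap.trace_eq_sum_inner _ b, Complex.re_sum]
  refine Finset.sum_le_sum fun i _ => ?_
  have hbi : b i = InnerProductSpace.gramSchmidtNormed ℂ f' i := by
    apply InnerProductSpace.gramSchmidtOrthonormalBasis_apply
    intro h
    have := InnerProductSpace.gramSchmidtNormed_unit_length i hf'
    rw [h, norm_zero] at this
    exact zero_ne_one this
  have hspan : (b i : E) ∈ span ℂ (f '' Set.Iic i) := by
    have h1 : b i ∈ span ℂ (f' '' Set.Iic i) := by
      rw [hbi]
      exact smul_mem _ _ (InnerProductSpace.gramSchmidt_mem_span ℂ f' le_rfl)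
    have h2 := mem_map_of_mem (f := V.subtype) h1
    rw [map_span, ← Set.image_comp] at h2
    exact h2
  have h3 := hc i _ hspan
  have h4 : ‖(b i : E)‖ = 1 := b.norm_eq_one i
  rw [h4] at h3
  have h5 : inner ℂ (b i) ((V.orthogonalProjectionOnto.toLinearMap ∘ₗ T ∘ₗ V.subtype) (b i)) =
      inner ℂ (b i : E) (T (b i)) := by
    simp
  rw [h5]
  simpa using h3

lemma sum_sum_le_zero_of_flags {E ι : Type*} {κ : ι → Type*} [NormedAddCommGroup E]
    [InnerProductSpace ℂ E] [FiniteDimensional ℂ E] [Fintype ι] [∀ s, Fintype (κ s)]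
    [∀ s, LinearOrder (κ s)] (V : Submodule ℂ E)
    (hcard : ∀ s, Module.finrank ℂ V = Fintype.card (κ s)) (f : ∀ s, κ s → E)
    (hf : ∀ s, LinearIndependent ℂ (f s))
    (hV : ∀ s i, f s i ∈ V) (T : ι → E →ₗ[ℂ] E) (hT : ∑ s, T s = 0) (c : ∀ s, κ s → ℝ)
    (hc : ∀ s i, ∀ x ∈ Submodule.span ℂ (f s '' Set.Iic i),
      c s i * ‖x‖ ^ 2 ≤ (inner ℂ x (T s x)).re) :
    ∑ s, ∑ i, c s i ≤ 0 := by
  calc ∑ s, ∑ i, c s i ≤ ∑ s, (LinearMap.trace ℂ V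
      (V.orthogonalProjectionOnto.toLinearMap ∘ₗ T s ∘ₗ V.subtype)).re :=
        Finset.sum_le_sum fun s _ =>
          sum_le_trace_compression V (hcard s) (f s) (hf s) (hV s) (T s) (c s) (hc s)
    _ = 0 := by
        rw [← Complex.re_sum, ← map_sum]
        have : ∑ s, V.orthogonalProjectionOnto.toLinearMap ∘ₗ T s ∘ₗ V.subtype =
            V.orthogonalProjectionOnto.toLinearMap ∘ₗ (∑ s, T s) ∘ₗ V.subtype := by
          ext x; simp
        rw [this, hT]
        simp

end Compression

section Schubert

variable {N ι : Type*} [Fintype N] [LinearOrder N] [Fintype ι]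

lemma sum_sum_le_zero_of_flagParam (h : ι → Matrix N N ℂ) (F : ι → Finset N)
    (E : Matrix N N ℂ)
    (hE : ∀ s, E * h s = h s * diagonal fun i => if i ∈ F s then 1 else 0)
    (x : FlagCoord N ι → ℂ) (hx : ∀ s, (flagParam h F x s).det ≠ 0) (X : ι → Matrix N N ℂ)
    (hX : ∑ s, X s = 0) (c : ι → N → ℝ)
    (hc : ∀ s i, ∀ y : N → ℂ, (∀ j, i < j → y j = 0) →
      c s i * (star (flagParam h F x s *ᵥ y) ⬝ᵥ (flagParam h F x s *ᵥ y)).re ≤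
        (star (flagParam h F x s *ᵥ y) ⬝ᵥ (X s *ᵥ (flagParam h F x s *ᵥ y))).re) :
    ∑ s, ∑ i ∈ F s, c s i ≤ 0 := by
  classical
  rcases isEmpty_or_nonempty ι with hι | ⟨⟨s₀⟩⟩
  · simp
  set g : Matrix N N ℂ := Matrix.of fun a b => x (Sum.inl (a, b)) with hg
  set P : ι → Matrix N N ℂ := fun s => Matrix.of fun j i =>
    if i ∈ F s ∧ j ∉ F s then 0 else x (Sum.inr (Sum.inl (s, j, i))) with hP
  set u : ι → Matrix N N ℂ := fun s => Matrix.of fun j i =>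
    if i < j then 0 else x (Sum.inr (Sum.inr (s, j, i))) with hu
  have hfp : ∀ s, flagParam h F x s = g * h s * P s * u s := fun s => rfl
  have hdet : ∀ s, g.det ≠ 0 ∧ (h s).det ≠ 0 ∧ (P s).det ≠ 0 ∧ (u s).det ≠ 0 := by
    intro s
    have := hx s
    rw [hfp, det_mul, det_mul, det_mul] at this
    refine ⟨?_, ?_, ?_, ?_⟩ <;> intro h0 <;> simp [h0] at this
  let D : ι → Matrix N N ℂ := fun s => diagonal fun i => if i ∈ F s then 1 else 0
  let V : Submodule ℂ (EuclideanSpace ℂ N) := (toEuclideanLin (g * E)).range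
  have hrank : ∀ s, Module.finrank ℂ V = Fintype.card {i // i ∈ F s} := by
    intro s
    have h1 : (g * E).rank = (D s).rank := by
      rw [rank_mul_eq_right_of_isUnit_det _ _ (isUnit_iff_ne_zero.mpr (hdet s₀).1),
        ← rank_mul_eq_left_of_isUnit_det (h s) E (isUnit_iff_ne_zero.mpr (hdet s).2.1), hE s,
        rank_mul_eq_right_of_isUnit_det _ _ (isUnit_iff_ne_zero.mpr (hdet s).2.1)]
    have h2 : (g * E).rank = Module.finrank ℂ V := by
      rw [rank_eq_finrank_range_toLin (g * E) (PiLp.basisFun 2 ℂ N) (PiLp.basisFun 2 ℂ N),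
        ← toLpLin_eq_toLin]
    rw [← h2, h1, rank_diagonal]
    refine Fintype.card_congr (Equiv.subtypeEquivRight fun i => ?_)
    by_cases hi : i ∈ F s <;> simp [hi]
  let M : ι → Matrix N N ℂ := fun s => g * h s * P s
  let f : ∀ s, {i // i ∈ F s} → EuclideanSpace ℂ N := fun s i =>
    WithLp.toLp 2 (M s *ᵥ Pi.single (i : N) 1)
  have hMdet : ∀ s, IsUnit (M s) := by
    intro s
    rw [isUnit_iff_isUnit_det, det_mul, det_mul, isUnit_iff_ne_zero]
    obtain ⟨h1, h2, h3, _⟩ := hdet s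
    exact mul_ne_zero (mul_ne_zero h1 h2) h3
  have hf : ∀ s, LinearIndependent ℂ (f s) := by
    intro s
    have h1 := (linearIndependent_cols_of_isUnit (hMdet s)).comp
      (fun i : {i // i ∈ F s} => (i : N)) Subtype.val_injective
    apply LinearIndependent.of_comp (WithLp.linearEquiv 2 ℂ (N → ℂ)).toLinearMap
    have h2 : (WithLp.linearEquiv 2 ℂ (N → ℂ)).toLinearMap ∘ f s =
        (M s).col ∘ fun i : {i // i ∈ F s} => (i : N) := by
      funext i
      ext j
      simp [f]
    rw [h2]
    exact h1
  have hfV : ∀ s i, f s i ∈ V := by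
    intro s i
    have hDP : D s * P s * D s = P s * D s := by
      ext a b
      simp only [D, hP, diagonal_mul, mul_diagonal, of_apply]
      by_cases ha : a ∈ F s <;> by_cases hb : b ∈ F s <;> simp [ha, hb]
    have hD : D s *ᵥ Pi.single (i : N) 1 = Pi.single (i : N) 1 := by
      ext a
      simp only [D, mulVec_diagonal, Pi.single_apply]
      split_ifs with h1 h2 <;> simp_all
    refine ⟨WithLp.toLp 2 (h s *ᵥ (P s *ᵥ Pi.single (i : N) 1)), ?_⟩
    rw [toLpLin_toLp, toLin'_apply]
    congr 1
    simp only [M, mulVec_mulVec]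
    rw [← mul_assoc]
    have : g * E * h s * P s = g * h s * (D s * P s) := by
      rw [mul_assoc g, hE s]; simp only [D, mul_assoc]
    rw [this]
    nth_rewrite 1 [← hD]
    rw [mulVec_mulVec, mul_assoc, hDP, ← mul_assoc, ← mulVec_mulVec, hD]
  have hspan : ∀ s (i : {i // i ∈ F s}), ∀ v ∈ Submodule.span ℂ (f s '' Set.Iic i),
      ∃ y : N → ℂ, (∀ j, (i : N) < j → y j = 0) ∧
        v = WithLp.toLp 2 (flagParam h F x s *ᵥ y) := by
    intro s i v hv
    have hut : (u s).BlockTriangular id := by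
      intro a b hab
      simp only [id] at hab
      simp [hu, hab]
    have hudet : IsUnit (u s).det := isUnit_iff_ne_zero.mpr (hdet s).2.2.2
    have : Invertible (u s) := (u s).invertibleOfIsUnitDet hudet
    have huinv := blockTriangular_inv_of_blockTriangular hut
    induction hv using Submodule.span_induction with
    | mem v hv =>
      obtain ⟨k, hk, rfl⟩ := hv
      refine ⟨(u s)⁻¹ *ᵥ Pi.single (k : N) 1, ?_, ?_⟩
      · intro j hj
        have hkj : (k : N) < j := lt_of_le_of_lt hk hj
        simpa using huinv hkj
      · simp only [f]
        congr 1
        rw [mulVec_mulVec, hfp, mul_assoc _ (u s), mul_nonsing_inv _ hudet, mul_one]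
    | zero => exact ⟨0, by simp, by simp⟩
    | add v w _ _ hv hw =>
      obtain ⟨y, hy, rfl⟩ := hv
      obtain ⟨z, hz, rfl⟩ := hw
      refine ⟨y + z, fun j hj => by simp [hy j hj, hz j hj], by rw [mulVec_add]; rfl⟩
    | smul a v _ hv =>
      obtain ⟨y, hy, rfl⟩ := hv
      refine ⟨a • y, fun j hj => by simp [hy j hj], by rw [mulVec_smul]; rfl⟩
  have key := sum_sum_le_zero_of_flags V hrank f hf hfV (fun s => toEuclideanLin (X s))
    (by rw [← map_sum, hX, map_zero]) (fun s i => c s i) ?_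
  · refine le_trans (le_of_eq ?_) key
    refine Finset.sum_congr rfl fun s _ => ?_
    exact (Finset.sum_coe_sort (F s) (c s)).symm
  · intro s i v hv
    obtain ⟨y, hy, rfl⟩ := hspan s i v hv
    have := hc s i y hy
    rw [toLpLin_toLp, toLin'_apply, EuclideanSpace.inner_toLp_toLp]
    have hn : ‖(WithLp.toLp 2 (flagParam h F x s *ᵥ y) : EuclideanSpace ℂ N)‖ ^ 2 =
        (star (flagParam h F x s *ᵥ y) ⬝ᵥ (flagParam h F x s *ᵥ y)).re := by
      rw [← inner_self_eq_norm_sq (𝕜 := ℂ), EuclideanSpace.inner_toLp_toLp, dotProduct_comm]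
      rfl
    rw [hn, dotProduct_comm (X s *ᵥ _)]
    exact this

end Schubert

section Schubert

variable {N ι : Type*} [Fintype N] [LinearOrder N] [Fintype ι]

/-- Near a unitary matrix that diagonalizes `X`, the quadratic form of `X` is almost bounded
below by `l i` on the span of the columns of index at most `i`. -/
lemma eventually_quadForm_lower_bound (U : Matrix N N ℂ) (hU : Uᴴ * U = 1) (l : N → ℝ)
    (hl : Antitone l) (X : Matrix N N ℂ) (hX : X * U = U * diagonal fun i => (l i : ℂ)) {δ : ℝ}
    (hδ : 0 < δ) :
    ∀ᶠ H in nhds U, ∀ i, ∀ y : N → ℂ, (∀ j, i < j → y j = 0) →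
      (l i - δ) * (star (H *ᵥ y) ⬝ᵥ (H *ᵥ y)).re ≤ (star (H *ᵥ y) ⬝ᵥ (X *ᵥ (H *ᵥ y))).re := by
  rw [Filter.eventually_all]
  intro i
  let K : Set (N → ℂ) := Metric.sphere 0 1 ∩ {y | ∀ j, i < j → y j = 0}
  have hK : IsCompact K := by
    refine (isCompact_sphere 0 1).inter_right ?_
    have : {y : N → ℂ | ∀ j, i < j → y j = 0} = ⋂ j, ⋂ (_ : i < j), {y | y j = 0} := by
      ext; simp
    rw [this]
    exact isClosed_iInter fun j => isClosed_iInter fun _ =>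
      isClosed_eq (continuous_apply j) continuous_const
  let Q : Matrix N N ℂ → (N → ℂ) → ℝ := fun H y =>
    (star (H *ᵥ y) ⬝ᵥ (X *ᵥ (H *ᵥ y))).re - (l i - δ) * (star (H *ᵥ y) ⬝ᵥ (H *ᵥ y)).re
  have hQc : Continuous fun z : Matrix N N ℂ × (N → ℂ) => Q z.1 z.2 := by
    have h1 : Continuous fun z : Matrix N N ℂ × (N → ℂ) => z.1 *ᵥ z.2 :=
      continuous_fst.matrix_mulVec continuous_snd
    have h2 : Continuous fun z : Matrix N N ℂ × (N → ℂ) => X *ᵥ (z.1 *ᵥ z.2) :=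
      continuous_const.matrix_mulVec h1
    exact (Complex.continuous_re.comp (h1.star.dotProduct h2)).sub
      (continuous_const.mul (Complex.continuous_re.comp (h1.star.dotProduct h1)))
  have hpos : ∀ y ∈ K, 0 < Q U y := by
    rintro y ⟨hy1, hy2⟩
    have h1 : star (U *ᵥ y) ⬝ᵥ (U *ᵥ y) = star y ⬝ᵥ y := by
      rw [star_mulVec, ← dotProduct_mulVec, mulVec_mulVec, hU, one_mulVec]
    have h2 : star (U *ᵥ y) ⬝ᵥ (X *ᵥ (U *ᵥ y)) =
        star y ⬝ᵥ ((diagonal fun i => (l i : ℂ)) *ᵥ y) := by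
      rw [star_mulVec, ← dotProduct_mulVec, mulVec_mulVec, mulVec_mulVec, mul_assoc,
        hX, ← mul_assoc, hU, one_mul]
    have h3 : Q U y = ∑ j, (l j - (l i - δ)) * Complex.normSq (y j) := by
      simp only [Q]
      rw [h1, h2]
      simp only [dotProduct, mulVec_diagonal, Complex.re_sum, Finset.mul_sum]
      rw [← Finset.sum_sub_distrib]
      refine Finset.sum_congr rfl fun j _ => ?_
      simp [Complex.normSq_apply]
      ring
    have hne : y ≠ 0 := by
      rintro rfl
      simp at hy1
    obtain ⟨k, hk⟩ := Function.ne_iff.mp hne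
    rw [h3]
    have hterm : ∀ j, y j ≠ 0 → 0 < l j - (l i - δ) := by
      intro j hj
      have : j ≤ i := le_of_not_gt fun hij => hj (hy2 j hij)
      linarith [hl this]
    refine Finset.sum_pos' (fun j _ => ?_) ⟨k, Finset.mem_univ _, ?_⟩
    · by_cases hj : y j = 0
      · simp [hj]
      · exact mul_nonneg (hterm j hj).le (Complex.normSq_nonneg _)
    · exact mul_pos (hterm k hk) (Complex.normSq_pos.mpr hk)
  have hev : ∀ᶠ H in nhds U, ∀ y ∈ K, 0 < Q H y := by
    refine hK.eventually_forall_of_forall_eventually fun y hy => ?_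
    exact hQc.continuousAt.eventually (lt_mem_nhds (hpos y hy))
  filter_upwards [hev] with H hH y hy
  by_cases h0 : y = 0
  · simp [h0]
  have hn : ‖y‖ ≠ 0 := norm_ne_zero_iff.mpr h0
  set a : ℂ := ((‖y‖⁻¹ : ℝ) : ℂ) with ha
  have hmem : a • y ∈ K := by
    refine ⟨?_, fun j hj => by simp [hy j hj]⟩
    simp [ha, norm_smul, hn]
  have h4 := hH _ hmem
  have h5 : Q H (a • y) = ‖y‖⁻¹ ^ 2 * Q H y := by
    simp only [Q, mulVec_smul, star_smul, smul_dotProduct, dotProduct_smul, smul_eq_mul]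
    simp only [ha, Complex.star_def, Complex.conj_ofReal, Complex.re_ofReal_mul]
    ring
  rw [h5] at h4
  have h6 : 0 < Q H y := by
    have : 0 < ‖y‖⁻¹ ^ 2 := by positivity
    exact (pos_iff_pos_of_mul_pos h4).mp this
  simp only [Q] at h6
  linarith

/-- If `h s` are orthonormal frames sharing the subspaces spanned by the vectors with index in
`F s`, and if the corresponding Schubert cells intersect transversally, then the Horn type
inequality indexed by the sets `F s` holds for all symmetric matrices that sum to zero. -/
theorem schubert_inequality (h : ι → Matrix N N ℝ) (F : ι → Finset N)
    (hh : ∀ s, (h s)ᵀ * h s = 1) (E : Matrix N N ℝ)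
    (hE : ∀ s, E * h s = h s * diagonal fun i => if i ∈ F s then 1 else 0)
    (hsurj : ∀ Y : ι → Matrix N N ℝ, ∃ Φ : Matrix N N ℝ, ∀ s, ∀ i ∈ F s, ∀ j ∉ F s, i < j →
      ((h s)ᵀ * (Y s - Φ) * h s) j i = 0)
    (U : ι → Matrix N N ℝ) (hU : ∀ s, (U s)ᵀ * U s = 1) (l : ι → N → ℝ)
    (hl : ∀ s, Antitone (l s)) (hsum : ∑ s, U s * diagonal (l s) * (U s)ᵀ = 0) :
    ∑ s, ∑ i ∈ F s, l s i ≤ 0 := by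
  let cx : Matrix N N ℝ → Matrix N N ℂ := fun A => A.map (Complex.ofRealHom)
  have cx_mul : ∀ A B, cx (A * B) = cx A * cx B := fun A B => Matrix.map_mul
  have cx_one : cx 1 = 1 := Matrix.map_one _ (map_zero _) (map_one _)
  have cx_tr : ∀ A, cx Aᵀ = (cx A)ᵀ := fun A => rfl
  have cx_diag : ∀ d : N → ℝ, cx (diagonal d) = diagonal fun i => (d i : ℂ) := fun d =>
    diagonal_map (map_zero _)
  have hdense := dense_range_flagParam (fun s => cx (h s)) F
    (fun s => by rw [← cx_tr, ← cx_mul, hh, cx_one]) (by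
      intro Y
      obtain ⟨Φ₁, h₁⟩ := hsurj fun s => (Y s).map Complex.re
      obtain ⟨Φ₂, h₂⟩ := hsurj fun s => (Y s).map Complex.im
      refine ⟨cx Φ₁ + Complex.I • cx Φ₂, fun s i hi j hj hij => ?_⟩
      have hY : Y s = cx ((Y s).map Complex.re) + Complex.I • cx ((Y s).map Complex.im) := by
        ext a b
        simp [cx, mul_comm Complex.I]
      have : (cx (h s))ᵀ * (Y s - (cx Φ₁ + Complex.I • cx Φ₂)) * cx (h s) =
          cx ((h s)ᵀ * ((Y s).map Complex.re - Φ₁) * h s) +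
            Complex.I • cx ((h s)ᵀ * ((Y s).map Complex.im - Φ₂) * h s) := by
        rw [cx_mul, cx_mul, cx_mul, cx_mul, cx_tr]
        have hsub : ∀ A B, cx (A - B) = cx A - cx B := fun A B => Matrix.map_sub _ (map_sub _) _ _
        rw [hsub, hsub]
        nth_rewrite 1 [hY]
        rw [← smul_mul_assoc, ← mul_smul_comm, ← add_mul, ← mul_add]
        congr 2
        rw [smul_sub]
        abel
      rw [this, Matrix.add_apply, Matrix.smul_apply]
      simp only [cx, map_apply]
      rw [h₁ s i hi j hj hij, h₂ s i hi j hj hij]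
      simp)
  refine le_of_forall_pos_le_add fun ε hε => ?_
  set δ : ℝ := ε / (∑ s, ((F s).card : ℝ) + 1) with hδ
  have hcard : (0 : ℝ) < ∑ s, ((F s).card : ℝ) + 1 :=
    add_pos_of_nonneg_of_pos (Finset.sum_nonneg fun _ _ => Nat.cast_nonneg _) one_pos
  have hδ0 : 0 < δ := div_pos hε hcard
  let X : ι → Matrix N N ℂ := fun s => cx (U s * diagonal (l s) * (U s)ᵀ)
  let z₀ : ι × N × N → ℂ := fun k => cx (U k.1) k.2.1 k.2.2
  let M : (ι × N × N → ℂ) → ι → Matrix N N ℂ := fun z s => Matrix.of fun a b => z (s, a, b)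
  have hcont : ∀ s, Continuous fun z => M z s := fun s =>
    continuous_matrix fun a b => continuous_apply (s, a, b)
  have hev : ∀ᶠ z in nhds z₀, ∀ s, (M z s).det ≠ 0 ∧
      ∀ i, ∀ y : N → ℂ, (∀ j, i < j → y j = 0) →
      (l s i - δ) * (star (M z s *ᵥ y) ⬝ᵥ (M z s *ᵥ y)).re ≤
        (star (M z s *ᵥ y) ⬝ᵥ (X s *ᵥ (M z s *ᵥ y))).re := by
    rw [Filter.eventually_all]
    intro s
    have hUs : (cx (U s))ᵀ * cx (U s) = 1 := by rw [← cx_tr, ← cx_mul, hU, cx_one]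
    have hUH : (cx (U s))ᴴ = (cx (U s))ᵀ := by
      ext a b
      simp [cx]
    have h1 := eventually_quadForm_lower_bound (cx (U s)) (by rw [hUH, hUs]) (l s) (hl s) (X s)
      (by
        simp only [X]
        rw [cx_mul, cx_mul, cx_diag, mul_assoc, cx_tr, hUs, mul_one]) hδ0
    have h2 : ∀ᶠ H in nhds (cx (U s)), H.det ≠ 0 := by
      have hc : Continuous fun H : Matrix N N ℂ => H.det := continuous_id.matrix_det
      refine hc.continuousAt.eventually_ne ?_
      intro h0
      have := congrArg det hUs
      rw [det_mul, h0, mul_zero, det_one] at this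
      exact zero_ne_one this
    have h3 : Filter.Tendsto (fun z => M z s) (nhds z₀) (nhds (cx (U s))) := (hcont s).tendsto z₀
    exact (h3.eventually h2).and (h3.eventually h1)
  obtain ⟨z, ⟨x, rfl⟩, hz⟩ := hdense.inter_nhds_nonempty hev
  have key := sum_sum_le_zero_of_flagParam (fun s => cx (h s)) F (cx E)
    (fun s => by
      rw [← cx_mul, hE, cx_mul, cx_diag]
      congr 2
      funext i
      split_ifs <;> simp) x (fun s => (hz s).1) X
    (by
      have : ∑ s, X s = cx (∑ s, U s * diagonal (l s) * (U s)ᵀ) := by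
        ext a b
        simp only [X, cx, Matrix.sum_apply, map_apply, map_sum]
      rw [this, hsum]
      ext; simp [cx]) (fun s i => l s i - δ) (fun s => (hz s).2)
  simp only [Finset.sum_sub_distrib, Finset.sum_const, nsmul_eq_mul] at key
  rw [← Finset.sum_mul] at key
  have : (∑ s, ((F s).card : ℝ)) * δ ≤ ε := by
    rw [hδ, mul_div_assoc', div_le_iff₀ hcard]
    nlinarith
  linarith

end Schubert

section Config

variable {N ι : Type*} [Fintype N] [DecidableEq N]

lemma trace_transpose_mul_commutator (Φ h : Matrix N N ℝ) (hh : hᵀ * h = 1) (d : N → ℝ) :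
    (Φᵀ * (Φ * (h * diagonal d * hᵀ) - h * diagonal d * hᵀ * Φ)).trace =
      ∑ j, ∑ i, (hᵀ * Φ * h) j i ^ 2 * (d i - d j) := by
  set φ := hᵀ * Φ * h with hφ
  have hh' : h * hᵀ = 1 := mul_eq_one_comm.mp hh
  have hΦ : Φ = h * φ * hᵀ := by
    rw [hφ, ← mul_assoc, ← mul_assoc, hh', one_mul, mul_assoc, hh', mul_one]
  have h1 : Φᵀ * (Φ * (h * diagonal d * hᵀ) - h * diagonal d * hᵀ * Φ) =
      h * (φᵀ * (φ * diagonal d - diagonal d * φ)) * hᵀ := by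
    have e1 : Φ * (h * diagonal d * hᵀ) = h * (φ * diagonal d) * hᵀ := by
      rw [hΦ]
      calc h * φ * hᵀ * (h * diagonal d * hᵀ) = h * φ * (hᵀ * h) * diagonal d * hᵀ := by
            simp only [mul_assoc]
        _ = _ := by rw [hh, mul_one]; simp only [mul_assoc]
    have e2 : h * diagonal d * hᵀ * Φ = h * (diagonal d * φ) * hᵀ := by
      rw [hΦ]
      calc h * diagonal d * hᵀ * (h * φ * hᵀ) = h * diagonal d * (hᵀ * h) * φ * hᵀ := by
            simp only [mul_assoc]
        _ = _ := by rw [hh, mul_one]; simp only [mul_assoc]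
    rw [e1, e2, ← sub_mul, ← mul_sub, hΦ]
    simp only [transpose_mul, transpose_transpose]
    calc h * (φᵀ * hᵀ) * (h * (φ * diagonal d - diagonal d * φ) * hᵀ) =
        h * φᵀ * (hᵀ * h) * (φ * diagonal d - diagonal d * φ) * hᵀ := by simp only [mul_assoc]
      _ = _ := by rw [hh, mul_one]; simp only [mul_assoc]
  have h2 : ∀ i, (φᵀ * (φ * diagonal d - diagonal d * φ)) i i =
      ∑ j, φ j i ^ 2 * (d i - d j) := by
    intro i
    rw [mul_apply]
    refine Finset.sum_congr rfl fun j _ => ?_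
    rw [Matrix.sub_apply, mul_diagonal, diagonal_mul, transpose_apply]
    ring
  rw [h1, trace_mul_comm, ← mul_assoc, hh, one_mul, trace]
  simp only [diag_apply, h2]
  exact Finset.sum_comm

/-- A matrix that is strictly block triangular for the sign of the eigenvalues of `M` and weakly
raises the flags of all the summands of `M` vanishes. -/
lemma eq_zero_of_flag_raising [Fintype ι] [LE N] (h : ι → Matrix N N ℝ) (hh : ∀ s, (h s)ᵀ * h s = 1)
    (l μ : ι → N → ℝ) (hl : ∀ s i j, j ≤ i → l s i ≤ l s j) (M : Matrix N N ℝ)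
    (hM : ∑ s, h s * diagonal (l s) * (h s)ᵀ = M) (t : ι)
    (hMt : M * h t = h t * diagonal (μ t)) (Φ : Matrix N N ℝ)
    (hΦ : ∀ s j i, ((h s)ᵀ * Φ * h s) j i ≠ 0 → 0 < μ s i ∧ μ s j ≤ 0 ∧ j ≤ i) : Φ = 0 := by
  have hMt' : M = h t * diagonal (μ t) * (h t)ᵀ := by
    rw [← hMt, mul_assoc, mul_eq_one_comm.mp (hh t), mul_one]
  have h1 := trace_transpose_mul_commutator Φ (h t) (hh t) (μ t)
  rw [← hMt', ← hM, Finset.mul_sum, Finset.sum_mul, ← Finset.sum_sub_distrib, Finset.mul_sum,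
    trace_sum] at h1
  have h2 : ∀ s, (Φᵀ * (Φ * (h s * diagonal (l s) * (h s)ᵀ) -
      h s * diagonal (l s) * (h s)ᵀ * Φ)).trace ≤ 0 := by
    intro s
    rw [trace_transpose_mul_commutator Φ (h s) (hh s)]
    refine Finset.sum_nonpos fun j _ => Finset.sum_nonpos fun i _ => ?_
    by_cases h0 : ((h s)ᵀ * Φ * h s) j i = 0
    · simp [h0]
    · have := hl s i j (hΦ s j i h0).2.2
      exact mul_nonpos_of_nonneg_of_nonpos (sq_nonneg _) (by linarith)
  have h3 := Finset.sum_nonpos fun s (_ : s ∈ Finset.univ) => h2 s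
  rw [h1] at h3
  have h4 : ∀ j i, 0 ≤ ((h t)ᵀ * Φ * h t) j i ^ 2 * (μ t i - μ t j) := by
    intro j i
    by_cases h0 : ((h t)ᵀ * Φ * h t) j i = 0
    · simp [h0]
    · have := hΦ t j i h0
      exact mul_nonneg (sq_nonneg _) (by linarith)
  have h5 : (h t)ᵀ * Φ * h t = 0 := by
    ext j i
    by_contra h0
    have := hΦ t j i h0
    have hpos : 0 < ((h t)ᵀ * Φ * h t) j i ^ 2 * (μ t i - μ t j) := by
      have h6 : 0 < μ t i - μ t j := by linarith
      exact mul_pos (sq_pos_iff.mpr h0) h6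
    refine absurd h3 (not_le.mpr ?_)
    exact Finset.sum_pos' (fun j _ => Finset.sum_nonneg fun i _ => h4 j i)
      ⟨j, Finset.mem_univ _, Finset.sum_pos' (fun i _ => h4 j i) ⟨i, Finset.mem_univ _, hpos⟩⟩
  have hh' : h t * (h t)ᵀ = 1 := mul_eq_one_comm.mp (hh t)
  calc Φ = h t * (h t)ᵀ * Φ * (h t * (h t)ᵀ) := by rw [hh', one_mul, mul_one]
    _ = h t * ((h t)ᵀ * Φ * h t) * (h t)ᵀ := by simp only [mul_assoc]
    _ = 0 := by rw [h5, mul_zero, zero_mul]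

lemma spectral_projection_mul {h k M : Matrix N N ℝ} (hh : hᵀ * h = 1) {μ ν : N → ℝ}
    (hM : M * h = h * diagonal μ) (kM : M * k = k * diagonal ν) (hMs : Mᵀ = M) (f : ℝ → ℝ) :
    h * diagonal (fun i => f (μ i)) * hᵀ * k = k * diagonal fun i => f (ν i) := by
  have h1 : hᵀ * M = diagonal μ * hᵀ := by
    have := congrArg transpose hM
    rwa [transpose_mul, transpose_mul, diagonal_transpose, hMs] at this
  have h2 : diagonal μ * (hᵀ * k) = hᵀ * k * diagonal ν := by
    rw [← mul_assoc, ← h1, mul_assoc, kM, mul_assoc]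
  have h3 : diagonal (fun i => f (μ i)) * (hᵀ * k) = hᵀ * k * diagonal fun i => f (ν i) := by
    ext i j
    have := congrFun (congrFun h2 i) j
    rw [diagonal_mul, mul_diagonal] at this ⊢
    by_cases h0 : (hᵀ * k) i j = 0
    · simp [h0]
    · have : μ i = ν j := mul_right_cancel₀ h0 (by rw [this, mul_comm])
      rw [this, mul_comm]
  rw [mul_assoc, mul_assoc, h3, ← mul_assoc, ← mul_assoc, mul_eq_one_comm.mp hh, one_mul]

end Config

section Config

variable {N ι : Type*} [Fintype N] [LinearOrder N] [Fintype ι]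

/-- The pairs that index the codimension of the Schubert cell of `F`. -/
def schubertPairs (F : Finset N) : Finset (N × N) :=
  Finset.univ.filter fun x => x.1 ∈ F ∧ x.2 ∉ F ∧ x.1 < x.2

/-- If the expected dimension is nonnegative, a diagonalization of `M` compatible with frames of
its summands yields a Horn type inequality. -/
theorem horn_inequality_of_common_eigenbasis (h : ι → Matrix N N ℝ) (hh : ∀ s, (h s)ᵀ * h s = 1)
    (l μ : ι → N → ℝ) (hl : ∀ s, Antitone (l s)) (M : Matrix N N ℝ)
    (hM : ∑ s, h s * diagonal (l s) * (h s)ᵀ = M) (hMμ : ∀ t, M * h t = h t * diagonal (μ t))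
    (F : ι → Finset N) (hF : ∀ s i, i ∈ F s ↔ 0 < μ s i) (t : ι)
    (hcount : ∑ s, (schubertPairs (F s)).card ≤ (F t).card * (F t)ᶜ.card)
    (U : ι → Matrix N N ℝ) (hU : ∀ s, (U s)ᵀ * U s = 1) (l' : ι → N → ℝ)
    (hl' : ∀ s, Antitone (l' s)) (hsum : ∑ s, U s * diagonal (l' s) * (U s)ᵀ = 0) :
    ∑ s, ∑ i ∈ F s, l' s i ≤ 0 := by
  have hMs : Mᵀ = M := by
    rw [← hM, transpose_sum]
    refine Finset.sum_congr rfl fun s _ => ?_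
    simp [transpose_mul, mul_assoc]
  have hh' : ∀ s, h s * (h s)ᵀ = 1 := fun s => mul_eq_one_comm.mp (hh s)
  let D : ι → Matrix N N ℝ := fun s => diagonal fun i => if i ∈ F s then 1 else 0
  have hD : ∀ s, D s = diagonal fun i => if 0 < μ s i then 1 else 0 := by
    intro s
    simp only [D, hF]
  let E : Matrix N N ℝ := h t * D t * (h t)ᵀ
  have hE : ∀ s, E * h s = h s * D s := by
    intro s
    simp only [E, hD]
    exact spectral_projection_mul (hh t) (hMμ t) (hMμ s) hMs fun x => if 0 < x then 1 else 0
  refine schubert_inequality h F hh E hE ?_ U hU l' hl' hsum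
  let W := {i // i ∈ F t} → {j // j ∈ (F t)ᶜ} → ℝ
  let Z := (Σ s, {x // x ∈ schubertPairs (F s)}) → ℝ
  let B : W →ₗ[ℝ] Matrix N N ℝ :=
    { toFun := fun w => Matrix.of fun j i =>
        if hi : i ∈ F t then if hj : j ∈ (F t)ᶜ then w ⟨i, hi⟩ ⟨j, hj⟩ else 0 else 0
      map_add' := by
        intro v w; ext j i
        simp only [of_apply, Matrix.add_apply]
        split_ifs
        · rfl
        · simp
        · simp
      map_smul' := by
        intro c w; ext j i
        simp only [of_apply, Matrix.smul_apply, RingHom.id_apply]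
        split_ifs
        · rfl
        · simp
        · simp }
  have hB1 : ∀ w, B w * D t = B w := by
    intro w
    ext j i
    simp only [D, mul_diagonal, B, LinearMap.coe_mk, AddHom.coe_mk, of_apply]
    split_ifs <;> simp
  have hB2 : ∀ w, D t * B w = 0 := by
    intro w
    ext j i
    simp only [D, diagonal_mul, B, LinearMap.coe_mk, AddHom.coe_mk, of_apply, Matrix.zero_apply]
    by_cases hj : j ∈ F t
    · have : j ∉ (F t)ᶜ := by simp [hj]
      simp [this]
    · simp [hj]
  let Φ : W → Matrix N N ℝ := fun w => h t * B w * (h t)ᵀ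
  have hΦ1 : ∀ w, Φ w * E = Φ w := by
    intro w
    simp only [Φ, E]
    rw [show h t * B w * (h t)ᵀ * (h t * D t * (h t)ᵀ) =
      h t * B w * ((h t)ᵀ * h t) * D t * (h t)ᵀ by simp only [mul_assoc], hh, mul_one,
      mul_assoc (h t), hB1]
  have hΦ2 : ∀ w, E * Φ w = 0 := by
    intro w
    simp only [Φ, E]
    rw [show h t * D t * (h t)ᵀ * (h t * B w * (h t)ᵀ) =
      h t * D t * ((h t)ᵀ * h t) * B w * (h t)ᵀ by simp only [mul_assoc], hh, mul_one,
      mul_assoc (h t), hB2, mul_zero, zero_mul]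
  have hEt : ∀ s, (h s)ᵀ * E = D s * (h s)ᵀ := by
    intro s
    calc (h s)ᵀ * E = (h s)ᵀ * E * (h s * (h s)ᵀ) := by rw [hh', mul_one]
      _ = (h s)ᵀ * (E * h s) * (h s)ᵀ := by simp only [mul_assoc]
      _ = (h s)ᵀ * h s * D s * (h s)ᵀ := by rw [hE]; simp only [mul_assoc]
      _ = _ := by rw [hh, one_mul]
  let L : W →ₗ[ℝ] Z :=
    { toFun := fun w k => ((h k.1)ᵀ * Φ w * h k.1) k.2.1.2 k.2.1.1
      map_add' := by
        intro v w; funext k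
        simp only [Φ, map_add, mul_add, add_mul, Matrix.add_apply]
        rfl
      map_smul' := by
        intro c w; funext k
        simp only [Φ, map_smul, mul_smul_comm, smul_mul_assoc, Matrix.smul_apply,
          RingHom.id_apply]
        rfl }
  have hinj : Function.Injective L := by
    rw [injective_iff_map_eq_zero]
    intro w hw
    have hΦ0 : Φ w = 0 := by
      refine eq_zero_of_flag_raising h hh l μ (fun s i j hij => hl s hij) M hM t (hMμ t) _ ?_
      intro s j i hne
      have h1 : ((h s)ᵀ * Φ w * h s) * D s = (h s)ᵀ * Φ w * h s := by
        rw [mul_assoc, ← hE, ← mul_assoc, mul_assoc _ (Φ w), hΦ1]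
      have h2 : D s * ((h s)ᵀ * Φ w * h s) = 0 := by
        rw [← mul_assoc, ← mul_assoc, ← hEt, mul_assoc _ E, hΦ2, mul_zero, zero_mul]
      have hi : i ∈ F s := by
        by_contra hi
        have := congrFun (congrFun h1 j) i
        simp only [D, mul_diagonal, if_neg hi, mul_zero] at this
        exact hne this.symm
      have hj : j ∉ F s := by
        intro hj
        have := congrFun (congrFun h2 j) i
        simp only [D, diagonal_mul, if_pos hj, one_mul, Matrix.zero_apply] at this
        exact hne this
      refine ⟨(hF s i).mp hi, not_lt.mp fun h0 => hj ((hF s j).mpr h0), not_lt.mp fun hij => ?_⟩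
      exact hne (congrFun hw ⟨s, (i, j), by simp [schubertPairs, hi, hj, hij]⟩)
    have hB0 : B w = 0 := by
      calc B w = (h t)ᵀ * h t * B w * ((h t)ᵀ * h t) := by rw [hh, one_mul, mul_one]
        _ = (h t)ᵀ * Φ w * h t := by simp only [Φ, mul_assoc]
        _ = 0 := by rw [hΦ0, mul_zero, zero_mul]
    funext i j
    have := congrFun (congrFun hB0 j) i
    simp only [B, LinearMap.coe_mk, AddHom.coe_mk, of_apply, i.2, j.2, dite_true] at this
    exact this
  have hdim : Module.finrank ℝ W = Module.finrank ℝ Z := by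
    have h1 : Module.finrank ℝ W = (F t).card * (F t)ᶜ.card := by
      simp only [W, Module.finrank_pi_fintype, Module.finrank_self, Finset.sum_const,
        Finset.card_univ, Fintype.card_coe, smul_eq_mul, mul_one]
    have h2 : Module.finrank ℝ Z = ∑ s, (schubertPairs (F s)).card := by
      simp [Z]
    refine le_antisymm (LinearMap.finrank_le_finrank_of_injective hinj) ?_
    rw [h1, h2]
    exact hcount
  have hsurj := (LinearMap.injective_iff_surjective_of_finrank_eq_finrank hdim).mp hinj
  intro Y
  obtain ⟨w, hw⟩ := hsurj fun k => ((h k.1)ᵀ * Y k.1 * h k.1) k.2.1.2 k.2.1.1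
  refine ⟨Φ w, fun s i hi j hj hij => ?_⟩
  have := congrFun hw ⟨s, (i, j), by simp [schubertPairs, hi, hj, hij]⟩
  simp only [L, LinearMap.coe_mk, AddHom.coe_mk] at this
  rw [mul_sub, sub_mul, Matrix.sub_apply, this, sub_self]

end Config

section SecondDerivative

lemma deriv_deriv_nonneg_of_forall_le {f f' : ℝ → ℝ} {x₀ c : ℝ} (hmin : ∀ t, f x₀ ≤ f t)
    (hf : ∀ t, HasDerivAt f (f' t) t) (hf' : HasDerivAt f' c x₀) : 0 ≤ c := by
  have hd : deriv f = f' := funext fun t => (hf t).deriv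
  have hlocmin : IsLocalMin f x₀ := Filter.Eventually.of_forall hmin
  by_contra hc
  have hmax : IsLocalMax f x₀ := by
    refine isLocalMax_of_deriv_deriv_neg ?_ hlocmin.deriv_eq_zero (hf x₀).continuousAt
    rw [hd, hf'.deriv]
    exact not_le.mp hc
  have hconst : f =ᶠ[nhds x₀] fun _ => f x₀ := by
    filter_upwards [hmax] with t ht using le_antisymm ht (hmin t)
  have h2 : f' =ᶠ[nhds x₀] fun _ => 0 := by
    have := hconst.deriv
    rw [hd] at this
    refine this.trans (Filter.Eventually.of_forall fun t => ?_)
    simp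
  exact hc (h2.hasDerivAt_iff.mp hf' |>.unique (hasDerivAt_const x₀ 0)).ge

end SecondDerivative

open scoped Matrix.Norms.Operator in
lemma HasDerivAt.matrix_trace {N : Type*} [Fintype N] {A : ℝ → Matrix N N ℝ}
    {A' : Matrix N N ℝ} {t : ℝ}
    (h : HasDerivAt A A' t) : HasDerivAt (fun t => (A t).trace) A'.trace t :=
  (LinearMap.toContinuousLinearMap (traceLinearMap N ℝ ℝ)).hasFDerivAt.comp_hasDerivAt t h

section Variation

variable {N ι : Type*} [Fintype N] [DecidableEq N] [Fintype ι]

/-- Conjugation of `a` by the one-parameter group generated by `X`. -/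
noncomputable def conjExp (X a : Matrix N N ℝ) (t : ℝ) : Matrix N N ℝ :=
  NormedSpace.exp (t • X) * a * NormedSpace.exp (t • -X)

lemma conjExp_zero (X a : Matrix N N ℝ) : conjExp X a 0 = a := by
  simp [conjExp]

open scoped Matrix.Norms.Operator in
lemma hasDerivAt_conjExp (X a : Matrix N N ℝ) (t : ℝ) :
    HasDerivAt (conjExp X a) (X * conjExp X a t - conjExp X a t * X) t := by
  have h1 := hasDerivAt_exp_smul_const' (𝕂 := ℝ) X t
  have h2 := hasDerivAt_exp_smul_const (𝕂 := ℝ) (-X) t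
  refine ((h1.mul_const a).mul h2).congr_deriv ?_
  simp only [conjExp, mul_assoc, mul_neg, sub_eq_add_neg]
  rfl

lemma exp_smul_mul_transpose {X : Matrix N N ℝ} (hX : Xᵀ = -X) (t : ℝ) :
    (NormedSpace.exp (t • X))ᵀ = NormedSpace.exp (t • -X) ∧
      (NormedSpace.exp (t • X))ᵀ * NormedSpace.exp (t • X) = 1 := by
  have h1 : (NormedSpace.exp (t • X))ᵀ = NormedSpace.exp (t • -X) := by
    rw [← exp_transpose, transpose_smul, hX]
  refine ⟨h1, ?_⟩
  rw [h1, ← exp_add_of_commute]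
  · simp
  · exact ((Commute.refl X).neg_left.smul_left t).smul_right t

open scoped Matrix.Norms.Operator in
lemma first_and_second_variation (a X : ι → Matrix N N ℝ)
    (hmin : ∀ t, ((∑ s, a s) * ∑ s, a s).trace ≤
      ((∑ s, conjExp (X s) (a s) t) * ∑ s, conjExp (X s) (a s) t).trace) :
    ((∑ s, a s) * ∑ s, (X s * a s - a s * X s)).trace = 0 ∧
      (∑ s, (X s * a s - a s * X s) = 0 →
        0 ≤ ((∑ s, a s) * ∑ s, (X s * (X s * a s - a s * X s) -
          (X s * a s - a s * X s) * X s)).trace) := by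
  let A : ι → ℝ → Matrix N N ℝ := fun s => conjExp (X s) (a s)
  let B : ι → ℝ → Matrix N N ℝ := fun s t => X s * A s t - A s t * X s
  let C : ι → ℝ → Matrix N N ℝ := fun s t => X s * B s t - B s t * X s
  have hA0 : ∀ s, A s 0 = a s := fun s => conjExp_zero _ _
  have hA : ∀ s t, HasDerivAt (A s) (B s t) t := fun s t => hasDerivAt_conjExp _ _ t
  have hB : ∀ s t, HasDerivAt (B s) (C s t) t := fun s t =>
    ((hA s t).const_mul (X s)).sub ((hA s t).mul_const (X s))
  have hM : ∀ t, HasDerivAt (fun t => ∑ s, A s t) (∑ s, B s t) t := fun t =>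
    HasDerivAt.fun_sum fun s _ => hA s t
  have hM' : ∀ t, HasDerivAt (fun t => ∑ s, B s t) (∑ s, C s t) t := fun t =>
    HasDerivAt.fun_sum fun s _ => hB s t
  have hf : ∀ t, HasDerivAt (fun t => ((∑ s, A s t) * ∑ s, A s t).trace)
      (2 * ((∑ s, A s t) * ∑ s, B s t).trace) t := by
    intro t
    refine ((hM t).mul (hM t)).matrix_trace.congr_deriv ?_
    rw [trace_add, trace_mul_comm (∑ s, B s t)]
    ring
  have hf' : ∀ t, HasDerivAt (fun t => 2 * ((∑ s, A s t) * ∑ s, B s t).trace)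
      (2 * (((∑ s, B s t) * ∑ s, B s t) + (∑ s, A s t) * ∑ s, C s t).trace) t :=
    fun t => (((hM t).mul (hM' t)).matrix_trace).const_mul 2
  have hmin' : ∀ t, ((∑ s, A s 0) * ∑ s, A s 0).trace ≤ ((∑ s, A s t) * ∑ s, A s t).trace := by
    intro t
    simp only [hA0]
    exact hmin t
  constructor
  · have h1 : IsLocalMin (fun t => ((∑ s, A s t) * ∑ s, A s t).trace) 0 :=
      Filter.Eventually.of_forall hmin'
    have := h1.hasDerivAt_eq_zero (hf 0)
    simp only [B, hA0] at this
    linarith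
  · intro h0
    have := deriv_deriv_nonneg_of_forall_le hmin' hf (hf' 0)
    simp only [B, C, hA0, h0, zero_mul, zero_add] at this
    linarith

end Variation

section Hessian

variable {N ι : Type*} [Fintype N] [LinearOrder N]

lemma conj_commutator_diagonal (k y : Matrix N N ℝ) (hk : kᵀ * k = 1) (l : N → ℝ) :
    k * y * kᵀ * (k * diagonal l * kᵀ) - k * diagonal l * kᵀ * (k * y * kᵀ) =
      k * (y * diagonal l - diagonal l * y) * kᵀ := by
  have h : ∀ a b : Matrix N N ℝ, k * a * kᵀ * (k * b * kᵀ) = k * (a * b) * kᵀ := by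
    intro a b
    rw [show k * a * kᵀ * (k * b * kᵀ) = k * a * (kᵀ * k) * b * kᵀ by simp only [mul_assoc], hk,
      mul_one, mul_assoc k]
  rw [h, h, mul_sub, sub_mul]

lemma trace_mul_double_commutator (k y M : Matrix N N ℝ) (hk : kᵀ * k = 1) (l μ : N → ℝ)
    (hM : M * k = k * diagonal μ) (hy : ∀ i j, y j i = -y i j) :
    (M * (k * y * kᵀ * (k * y * kᵀ * (k * diagonal l * kᵀ) - k * diagonal l * kᵀ * (k * y * kᵀ)) -
      (k * y * kᵀ * (k * diagonal l * kᵀ) - k * diagonal l * kᵀ * (k * y * kᵀ)) *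
        (k * y * kᵀ))).trace = -∑ i, ∑ j, (μ i - μ j) * (l i - l j) * y i j ^ 2 := by
  rw [conj_commutator_diagonal k y hk]
  set c := y * diagonal l - diagonal l * y with hc
  have hcij : ∀ i j, c i j = y i j * (l j - l i) := by
    intro i j
    rw [hc, Matrix.sub_apply, mul_diagonal, diagonal_mul]
    ring
  have h : ∀ a b : Matrix N N ℝ, k * a * kᵀ * (k * b * kᵀ) = k * (a * b) * kᵀ := by
    intro a b
    rw [show k * a * kᵀ * (k * b * kᵀ) = k * a * (kᵀ * k) * b * kᵀ by simp only [mul_assoc], hk,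
      mul_one, mul_assoc k]
  have h1 : M * (k * y * kᵀ * (k * c * kᵀ) - k * c * kᵀ * (k * y * kᵀ)) =
      k * (diagonal μ * (y * c - c * y)) * kᵀ := by
    rw [h, h, ← sub_mul, ← mul_sub, ← mul_assoc, ← mul_assoc, hM, mul_assoc k]
  rw [h1, trace_mul_comm, ← mul_assoc, hk, one_mul, trace]
  have h2 : ∀ i, (diagonal μ * (y * c - c * y)) i i =
      -(2 * ∑ j, μ i * (l i - l j) * y i j ^ 2) := by
    intro i
    rw [diagonal_mul, Matrix.sub_apply, mul_apply, mul_apply, ← Finset.sum_sub_distrib,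
      Finset.mul_sum, Finset.mul_sum, ← Finset.sum_neg_distrib]
    refine Finset.sum_congr rfl fun j _ => ?_
    rw [hcij, hcij, hy i j]
    ring
  simp only [diag_apply, h2, Finset.sum_neg_distrib, ← Finset.mul_sum]
  rw [two_mul]
  nth_rewrite 2 [Finset.sum_comm]
  rw [← Finset.sum_add_distrib]
  congr 1
  refine Finset.sum_congr rfl fun i _ => ?_
  rw [← Finset.sum_add_distrib]
  refine Finset.sum_congr rfl fun j _ => ?_
  rw [hy i j]
  ring

/-- Nonnegativity of the Hessian forces the expected dimension of the intersection of Schubert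
cells to be nonnegative. -/
lemma sum_card_schubertPairs_le [Fintype ι] (k : ι → Matrix N N ℝ) (hk : ∀ s, (k s)ᵀ * k s = 1)
    (l μ : ι → N → ℝ) (hl : ∀ s, StrictAnti (l s)) (M : Matrix N N ℝ)
    (hMs : Mᵀ = M) (hMμ : ∀ t, M * k t = k t * diagonal (μ t))
    (F : ι → Finset N) (hF : ∀ s i, i ∈ F s ↔ 0 < μ s i)
    (hsecond : ∀ X : ι → Matrix N N ℝ, (∀ s, (X s)ᵀ = -X s) →
      ∑ s, (X s * (k s * diagonal (l s) * (k s)ᵀ) - k s * diagonal (l s) * (k s)ᵀ * X s) = 0 →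
      0 ≤ (M * ∑ s, (X s * (X s * (k s * diagonal (l s) * (k s)ᵀ) -
        k s * diagonal (l s) * (k s)ᵀ * X s) - (X s * (k s * diagonal (l s) * (k s)ᵀ) -
        k s * diagonal (l s) * (k s)ᵀ * X s) * X s)).trace) (t : ι) :
    ∑ s, (schubertPairs (F s)).card ≤ (F t).card * (F t)ᶜ.card := by
  by_contra! hlt
  let W := {i // i ∈ F t} → {j // j ∈ (F t)ᶜ} → ℝ
  let Z := (Σ s, {x // x ∈ schubertPairs (F s)}) → ℝ
  let B : ι → Z →ₗ[ℝ] Matrix N N ℝ := fun s =>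
    { toFun := fun x => Matrix.of fun i j =>
        (if h : (i, j) ∈ schubertPairs (F s) then x ⟨s, _, h⟩ else 0) -
          (if h : (j, i) ∈ schubertPairs (F s) then x ⟨s, _, h⟩ else 0)
      map_add' := by
        intro v w; ext i j
        simp only [of_apply, Matrix.add_apply]
        have hvw : ∀ u, (v + w) u = v u + w u := fun _ => rfl
        split_ifs <;> (try simp only [hvw]) <;> ring
      map_smul' := by
        intro c w; ext j i
        simp only [of_apply, Matrix.smul_apply, RingHom.id_apply]
        have hcw : ∀ u, (c • w) u = c * w u := fun _ => rfl
        split_ifs <;> (try simp only [hcw]) <;> simp only [smul_eq_mul] <;> ring }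
  have hBskew : ∀ s x i j, B s x j i = -B s x i j := by
    intro s x i j
    simp only [B, LinearMap.coe_mk, AddHom.coe_mk, of_apply, neg_sub]
  have hBsupp : ∀ s x i j, B s x i j ≠ 0 →
      (i ∈ F s ∧ j ∉ F s ∧ i < j) ∨ (j ∈ F s ∧ i ∉ F s ∧ j < i) := by
    intro s x i j h0
    by_contra! hcon
    apply h0
    have h1 : (i, j) ∉ schubertPairs (F s) := by
      simp only [schubertPairs, Finset.mem_filter, Finset.mem_univ, true_and, not_and]
      exact fun h2 h3 h4 => absurd h4 (not_lt.mpr (hcon.1 h2 h3))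
    have h2 : (j, i) ∉ schubertPairs (F s) := by
      simp only [schubertPairs, Finset.mem_filter, Finset.mem_univ, true_and, not_and]
      exact fun h2 h3 h4 => absurd h4 (not_lt.mpr (hcon.2 h2 h3))
    simp [B, h1, h2]
  let T : Z →ₗ[ℝ] Matrix N N ℝ := ∑ s, (LinearMap.mulLeft ℝ (k s)) ∘ₗ
    (LinearMap.mulRight ℝ (k s)ᵀ) ∘ₗ
      (LinearMap.mulRight ℝ (diagonal (l s)) - LinearMap.mulLeft ℝ (diagonal (l s))) ∘ₗ B s
  let c : ι → Z → Matrix N N ℝ := fun s x => B s x * diagonal (l s) - diagonal (l s) * B s x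
  have hT : ∀ x, T x = ∑ s, k s * c s x * (k s)ᵀ := by
    intro x
    simp only [T, c, LinearMap.sum_apply, LinearMap.comp_apply, LinearMap.sub_apply,
      LinearMap.mulLeft_apply, LinearMap.mulRight_apply, mul_assoc]
  have hcij : ∀ s x i j, c s x i j = B s x i j * (l s j - l s i) := by
    intro s x i j
    simp only [c]
    rw [Matrix.sub_apply, mul_diagonal, diagonal_mul]
    ring
  let L : Z →ₗ[ℝ] W :=
    { toFun := fun x i j => ((k t)ᵀ * T x * k t) j i
      map_add' := by
        intro v w; funext i j
        simp only [map_add, mul_add, add_mul, Matrix.add_apply]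
        rfl
      map_smul' := by
        intro c w; funext i j
        simp only [map_smul, mul_smul_comm, smul_mul_assoc, Matrix.smul_apply,
          RingHom.id_apply]
        rfl }
  have hker : LinearMap.ker L ≠ ⊥ := by
    apply LinearMap.ker_ne_bot_of_finrank_lt
    have h1 : Module.finrank ℝ W = (F t).card * (F t)ᶜ.card := by
      simp only [W, Module.finrank_pi_fintype, Module.finrank_self, Finset.sum_const,
        Finset.card_univ, Fintype.card_coe, smul_eq_mul, mul_one]
    have h2 : Module.finrank ℝ Z = ∑ s, (schubertPairs (F s)).card := by
      simp [Z]
    rw [h1, h2]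
    exact hlt
  obtain ⟨x, hx, hx0⟩ := Submodule.exists_mem_ne_zero_of_ne_bot hker
  have hLx : L x = 0 := hx
  let D : ι → Matrix N N ℝ := fun s => diagonal fun i => if 0 < μ s i then 1 else 0
  let E : Matrix N N ℝ := k t * D t * (k t)ᵀ
  have hk' : ∀ s, k s * (k s)ᵀ = 1 := fun s => mul_eq_one_comm.mp (hk s)
  have hE : ∀ s, E * k s = k s * D s := fun s =>
    spectral_projection_mul (hk t) (hMμ t) (hMμ s) hMs fun x => if 0 < x then 1 else 0
  have hEt : ∀ s, (k s)ᵀ * E = D s * (k s)ᵀ := by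
    intro s
    calc (k s)ᵀ * E = (k s)ᵀ * E * (k s * (k s)ᵀ) := by rw [hk', mul_one]
      _ = (k s)ᵀ * (E * k s) * (k s)ᵀ := by simp only [mul_assoc]
      _ = (k s)ᵀ * k s * D s * (k s)ᵀ := by rw [hE]; simp only [mul_assoc]
      _ = _ := by rw [hk, one_mul]
  have hcD : ∀ s x, c s x * D s + D s * c s x = c s x := by
    intro s x
    ext i j
    rw [Matrix.add_apply, mul_diagonal, diagonal_mul, hcij]
    by_cases h0 : B s x i j = 0
    · simp [h0]
    · rcases hBsupp s x i j h0 with ⟨hi, hj, -⟩ | ⟨hj, hi, -⟩ <;> rw [hF] at hi hj <;> simp [hi, hj]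
  have hTE : T x * E + E * T x = T x := by
    rw [hT, Finset.sum_mul, Finset.mul_sum, ← Finset.sum_add_distrib]
    refine Finset.sum_congr rfl fun s _ => ?_
    rw [mul_assoc (k s * c s x), hEt, ← mul_assoc E, ← mul_assoc E, hE]
    nth_rewrite 3 [← hcD s x]
    simp only [mul_add, add_mul, mul_assoc]
  have hTs : (T x)ᵀ = T x := by
    rw [hT, transpose_sum]
    refine Finset.sum_congr rfl fun s _ => ?_
    have : (c s x)ᵀ = c s x := by
      ext i j
      rw [transpose_apply, hcij, hcij, hBskew s x i j]
      ring
    simp only [transpose_mul, transpose_transpose, this, mul_assoc]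
  have hT0 : T x = 0 := by
    set τ := (k t)ᵀ * T x * k t with hτ
    have h1 : τ * D t + D t * τ = τ := by
      calc τ * D t + D t * τ = (k t)ᵀ * (T x * E + E * T x) * k t := by
            rw [mul_add, add_mul, hτ, mul_assoc _ (k t) (D t), ← hE, ← mul_assoc (D t),
              ← mul_assoc (D t), ← hEt]
            simp only [mul_assoc]
        _ = τ := by rw [hTE]
    have h2 : ∀ i j, τ j i = τ i j := by
      intro i j
      have : τᵀ = τ := by
        rw [hτ]; simp only [transpose_mul, transpose_transpose, hTs, mul_assoc]
      exact congrFun (congrFun this i) j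
    have h3 : ∀ i j, i ∈ F t → j ∉ F t → τ j i = 0 := fun i j hi hj =>
      congrFun (congrFun hLx ⟨i, hi⟩) ⟨j, by simp [hj]⟩
    have h4 : τ = 0 := by
      ext j i
      have h5 := congrFun (congrFun h1 j) i
      rw [Matrix.add_apply, mul_diagonal, diagonal_mul] at h5
      by_cases hi : i ∈ F t <;> by_cases hj : j ∈ F t
      · simp only [(hF t i).mp hi, (hF t j).mp hj, if_true, mul_one, one_mul] at h5
        simp only [Matrix.zero_apply]
        linarith
      · exact h3 i j hi hj
      · rw [h2]; exact h3 j i hj hi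
      · rw [hF] at hi hj
        simp only [hi, hj, if_false, mul_zero, zero_mul, add_zero] at h5
        exact h5.symm
    calc T x = k t * (k t)ᵀ * T x * (k t * (k t)ᵀ) := by rw [hk', one_mul, mul_one]
      _ = k t * τ * (k t)ᵀ := by simp only [hτ, mul_assoc]
      _ = 0 := by rw [h4, mul_zero, zero_mul]
  have hsec := hsecond (fun s => k s * B s x * (k s)ᵀ) (by
      intro s
      have : (B s x)ᵀ = -B s x := by
        ext i j
        rw [transpose_apply, Matrix.neg_apply, hBskew]
      simp only [transpose_mul, transpose_transpose, this, mul_assoc, neg_mul, mul_neg])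
    (by
      rw [← hT0, hT]
      exact Finset.sum_congr rfl fun s _ => conj_commutator_diagonal (k s) (B s x) (hk s) (l s))
  rw [Finset.mul_sum, trace_sum] at hsec
  simp only [fun s => trace_mul_double_commutator (k s) (B s x) M (hk s) (l s) (μ s) (hMμ s)
    (hBskew s x), Finset.sum_neg_distrib] at hsec
  have hterm : ∀ s i j, B s x i j ≠ 0 →
      0 < (μ s i - μ s j) * (l s i - l s j) * B s x i j ^ 2 := by
    intro s i j h0
    refine mul_pos ?_ (sq_pos_iff.mpr h0)
    rcases hBsupp s x i j h0 with ⟨hi, hj, hij⟩ | ⟨hj, hi, hij⟩ <;> rw [hF] at hi hj <;>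
      have := hl s hij
    · exact mul_pos (by linarith) (by linarith)
    · exact mul_pos_of_neg_of_neg (by linarith) (by linarith)
  have hterm' : ∀ s i j, 0 ≤ (μ s i - μ s j) * (l s i - l s j) * B s x i j ^ 2 := by
    intro s i j
    by_cases h0 : B s x i j = 0
    · simp [h0]
    · exact (hterm s i j h0).le
  obtain ⟨⟨s, ⟨i, j⟩, hij⟩, hne⟩ := Function.ne_iff.mp hx0
  have hB0 : B s x i j ≠ 0 := by
    have hji : (j, i) ∉ schubertPairs (F s) := by
      simp only [schubertPairs, Finset.mem_filter, Finset.mem_univ, true_and] at hij ⊢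
      exact fun h => absurd h.2.2 hij.2.2.asymm
    have h : B s x i j = x ⟨s, (i, j), hij⟩ := by simp [B, hij, hji]
    rw [h]
    exact hne
  have hpos : 0 < ∑ s, ∑ i, ∑ j, (μ s i - μ s j) * (l s i - l s j) * B s x i j ^ 2 :=
    Finset.sum_pos' (fun s _ => Finset.sum_nonneg fun i _ => Finset.sum_nonneg fun j _ =>
      hterm' s i j) ⟨s, Finset.mem_univ _, Finset.sum_pos' (fun i _ => Finset.sum_nonneg fun j _ =>
      hterm' s i j) ⟨i, Finset.mem_univ _, Finset.sum_pos' (fun j _ => hterm' s i j)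
      ⟨j, Finset.mem_univ _, hterm s i j hB0⟩⟩⟩
  linarith

end Hessian

section Minimizer

variable {N ι : Type*} [Fintype N]

section

variable [DecidableEq N]

lemma isCompact_setOf_orthogonal_families :
    IsCompact {k : ι → Matrix N N ℝ | ∀ s, (k s)ᵀ * k s = 1} := by
  have h1 : IsCompact (Set.univ.pi fun _ => Set.univ.pi fun _ => Set.univ.pi fun _ =>
      Set.Icc (-1) 1 : Set (ι → N → N → ℝ)) :=
    isCompact_univ_pi fun _ => isCompact_univ_pi fun _ => isCompact_univ_pi fun _ => isCompact_Icc
  refine IsCompact.of_isClosed_subset h1 ?_ ?_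
  · rw [Set.ofPred_forall]
    exact isClosed_iInter fun s => isClosed_eq
      (by fun_prop : Continuous fun k : ι → Matrix N N ℝ => (k s)ᵀ * k s) continuous_const
  · intro k hk s _ i _ j _
    have h2 : ((k s)ᵀ * k s) j j = 1 := by rw [hk s, one_apply_eq]
    rw [mul_apply] at h2
    have h3 : k s i j * k s i j ≤ 1 := by
      rw [← h2]
      exact Finset.single_le_sum (f := fun x => (k s)ᵀ j x * k s x j)
        (fun x _ => mul_self_nonneg (k s x j)) (Finset.mem_univ i)
    exact Set.mem_Icc.mpr (abs_le.mp (abs_le_one_iff_mul_self_le_one.mpr h3))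

lemma exists_orthogonal_trace_sq_min [Fintype ι] (l : ι → N → ℝ) :
    ∃ k : ι → Matrix N N ℝ, (∀ s, (k s)ᵀ * k s = 1) ∧
      ∀ k' : ι → Matrix N N ℝ, (∀ s, (k' s)ᵀ * k' s = 1) →
        ((∑ s, k s * diagonal (l s) * (k s)ᵀ) * ∑ s, k s * diagonal (l s) * (k s)ᵀ).trace ≤
          ((∑ s, k' s * diagonal (l s) * (k' s)ᵀ) *
            ∑ s, k' s * diagonal (l s) * (k' s)ᵀ).trace := by
  obtain ⟨k, hk, hmin⟩ := (isCompact_setOf_orthogonal_families (N := N) (ι := ι)).exists_isMinOn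
    (f := fun k => ((∑ s, k s * diagonal (l s) * (k s)ᵀ) *
      ∑ s, k s * diagonal (l s) * (k s)ᵀ).trace) ⟨fun _ => 1, by simp⟩
    (Continuous.continuousOn (by fun_prop))
  exact ⟨k, hk, fun k' hk' => hmin hk'⟩

lemma conjExp_mul_mul_transpose {X : Matrix N N ℝ} (hX : Xᵀ = -X) (k a : Matrix N N ℝ) (t : ℝ) :
    conjExp X (k * a * kᵀ) t =
      (NormedSpace.exp (t • X) * k) * a * (NormedSpace.exp (t • X) * k)ᵀ := by
  rw [conjExp, transpose_mul, (exp_smul_mul_transpose hX t).1]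
  simp only [mul_assoc]

lemma eq_diagonal_of_commute_diagonal {l : N → ℝ} (hl : Function.Injective l)
    {A : Matrix N N ℝ} (h : A * diagonal l = diagonal l * A) : A = diagonal fun i => A i i := by
  ext i j
  by_cases hij : i = j
  · subst hij; simp
  · have h1 := congrFun (congrFun h i) j
    rw [mul_diagonal, diagonal_mul] at h1
    have h2 : A i j * (l j - l i) = 0 := by linarith
    rw [diagonal_apply_ne _ hij]
    exact (mul_eq_zero.mp h2).resolve_right (sub_ne_zero.mpr fun h3 => hij (hl h3).symm)

end

variable [LinearOrder N]

/-- A minimizer of `tr (∑ k diag(l) kᵀ)²` diagonalizes the sum in each of its frames, and its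
positive eigenspace meets each frame in a Schubert position of nonnegative expected dimension. -/
lemma exists_common_eigenbasis [Fintype ι] (l : ι → N → ℝ) (hl : ∀ s, StrictAnti (l s)) :
    ∃ (k : ι → Matrix N N ℝ) (M : Matrix N N ℝ) (μ : ι → N → ℝ), (∀ s, (k s)ᵀ * k s = 1) ∧
      ∑ s, k s * diagonal (l s) * (k s)ᵀ = M ∧ (∀ t, M * k t = k t * diagonal (μ t)) ∧
      ∀ F : ι → Finset N, (∀ s i, i ∈ F s ↔ 0 < μ s i) → ∀ t,
        ∑ s, (schubertPairs (F s)).card ≤ (F t).card * (F t)ᶜ.card := by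
  obtain ⟨k, hk, hmin⟩ := exists_orthogonal_trace_sq_min l
  set a : ι → Matrix N N ℝ := fun s => k s * diagonal (l s) * (k s)ᵀ with ha
  set M := ∑ s, a s with hM
  have hk' : ∀ s, k s * (k s)ᵀ = 1 := fun s => mul_eq_one_comm.mp (hk s)
  have has : ∀ s, (a s)ᵀ = a s := fun s => by
    simp only [ha, transpose_mul, transpose_transpose, diagonal_transpose, mul_assoc]
  have hMs : Mᵀ = M := by
    rw [hM, transpose_sum]
    exact Finset.sum_congr rfl fun s _ => has s
  have hvar : ∀ X : ι → Matrix N N ℝ, (∀ s, (X s)ᵀ = -X s) → _ := fun X hX =>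
    first_and_second_variation a X (fun t => by
      have h1 : ∀ s, conjExp (X s) (a s) t = (NormedSpace.exp (t • X s) * k s) *
          diagonal (l s) * (NormedSpace.exp (t • X s) * k s)ᵀ := fun s =>
        conjExp_mul_mul_transpose (hX s) _ _ t
      simp only [h1]
      refine hmin _ fun s => ?_
      rw [transpose_mul, mul_assoc, ← mul_assoc _ _ (k s), (exp_smul_mul_transpose (hX s) t).2,
        one_mul, hk])
  have hcomm : ∀ t, a t * M = M * a t := by
    intro t
    classical
    set c := a t * M - M * a t with hc
    have hcs : cᵀ = -c := by
      rw [hc, transpose_sub, transpose_mul (a t), transpose_mul M, has, hMs, neg_sub]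
    have h1 := (hvar (fun s => if s = t then c else 0) (by
      intro s; split_ifs
      · exact hcs
      · simp)).1
    have h2 : ∑ s, ((if s = t then c else 0) * a s - a s * (if s = t then c else 0)) =
        c * a t - a t * c := by
      rw [Finset.sum_eq_single t]
      · simp
      · intro s _ hs; simp [hs]
      · simp
    rw [h2] at h1
    have h3 : (M * (c * a t - a t * c)).trace = (c * c).trace := by
      rw [mul_sub, trace_sub, ← mul_assoc M c, trace_mul_comm (M * c) (a t), ← mul_assoc (a t),
        ← mul_assoc M (a t), ← trace_sub, ← sub_mul]
    have h4 : (cᵀ * c).trace = 0 := by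
      rw [hcs, neg_mul, trace_neg, ← h3, h1, neg_zero]
    exact sub_eq_zero.mp (by
      have := (Matrix.trace_conjTranspose_mul_self_eq_zero_iff (A := c)).mp
        (by rwa [conjTranspose_eq_transpose_of_trivial])
      exact this)
  have hdiag : ∀ t, (k t)ᵀ * M * k t = diagonal fun i => ((k t)ᵀ * M * k t) i i := by
    intro t
    refine eq_diagonal_of_commute_diagonal (hl t).injective ?_
    calc (k t)ᵀ * M * k t * diagonal (l t)
        = (k t)ᵀ * M * k t * diagonal (l t) * ((k t)ᵀ * k t) := by rw [hk, mul_one]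
      _ = (k t)ᵀ * (M * a t) * k t := by simp only [ha, mul_assoc]
      _ = (k t)ᵀ * (a t * M) * k t := by rw [hcomm]
      _ = (k t)ᵀ * k t * diagonal (l t) * (k t)ᵀ * M * k t := by simp only [ha, mul_assoc]
      _ = diagonal (l t) * ((k t)ᵀ * M * k t) := by rw [hk, one_mul]; simp only [mul_assoc]
  have hMμ : ∀ t, M * k t = k t * diagonal fun i => ((k t)ᵀ * M * k t) i i := by
    intro t
    rw [← hdiag, mul_assoc, ← mul_assoc (k t), hk', one_mul]
  exact ⟨k, M, fun t i => ((k t)ᵀ * M * k t) i i, hk, rfl, hMμ, fun F hF t =>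
    sum_card_schubertPairs_le k hk l _ hl M hMs hMμ F hF (fun X hX h0 => (hvar X hX).2 h0) t⟩

end Minimizer

lemma sum_mem_eq_sum_fin_two {N P : Type*} [Fintype N] [Fintype P] (e : N ≃ P × Fin 2)
    {F : Fin 2 → Finset P} {G : Finset N}
    (hG : ∀ x, x ∈ G ↔ (e x).1 ∈ F (e x).2) {R : Type*} [AddCommMonoid R] (f : N → R) :
    ∑ x ∈ G, f x = ∑ i ∈ F 0, f (e.symm (i, 0)) + ∑ i ∈ F 1, f (e.symm (i, 1)) := by
  classical
  have h1 : ∀ r, ∑ i ∈ F r, f (e.symm (i, r)) =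
      ∑ i, if i ∈ F r then f (e.symm (i, r)) else 0 := fun r => by
    rw [← Finset.sum_filter]; simp
  have h2 : ∑ x ∈ G, f x = ∑ x, if (e x).1 ∈ F (e x).2 then f x else 0 := by
    rw [← Finset.sum_filter]
    exact Finset.sum_congr (by ext x; simp [hG]) fun _ _ => rfl
  rw [h1, h1, h2, ← e.symm.sum_comp, Fintype.sum_prod_type_right, Fin.sum_univ_two]
  simp

section Doubling

variable {N P : Type*} [Fintype N] [LinearOrder N] [Fintype P] [LinearOrder P]

lemma card_schubertPairs_eq_sum (F : Finset N) : ((schubertPairs F).card : ℤ) =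
    ∑ i, ∑ j, if i < j then (if i ∈ F then 1 else 0) * (1 - if j ∈ F then 1 else 0) else 0 := by
  rw [schubertPairs, Finset.card_filter, Fintype.sum_prod_type]
  push_cast
  refine Finset.sum_congr rfl fun i _ => Finset.sum_congr rfl fun j _ => ?_
  split_ifs <;> simp_all

lemma two_mul_sum_lt_eq (d : P → ℤ) :
    2 * ∑ i, ∑ j, (if i < j then d i * d j else 0) = (∑ i, d i) ^ 2 - ∑ i, d i ^ 2 := by
  have h1 : (∑ i, d i) ^ 2 = ∑ i, ∑ j, ((if i < j then d i * d j else 0) +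
      (if j < i then d i * d j else 0) + if i = j then d i ^ 2 else 0) := by
    rw [sq, Finset.sum_mul_sum]
    refine Finset.sum_congr rfl fun i _ => Finset.sum_congr rfl fun j _ => ?_
    rcases lt_trichotomy i j with h | h | h
    · simp [h, h.not_gt, h.ne]
    · subst h; simp [sq]
    · simp [h, h.not_gt, h.ne']
  have h2 : ∑ i, ∑ j, (if j < i then d i * d j else 0) =
      ∑ i, ∑ j, (if i < j then d i * d j else 0) := by
    rw [Finset.sum_comm]
    simp only [mul_comm]
  simp only [Finset.sum_add_distrib, h2, Finset.sum_ite_eq, Finset.mem_univ, if_true] at h1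
  rw [h1]; ring

lemma card_schubertPairs_doubling (e : N ≃ P × Fin 2)
    (he : ∀ x y, x < y ↔ (e x).1 < (e y).1 ∨ (e x).1 = (e y).1 ∧ (e x).2 < (e y).2)
    {F : Fin 2 → Finset P} (hF : (F 0).card = (F 1).card) {G : Finset N}
    (hG : ∀ x, x ∈ G ↔ (e x).1 ∈ F (e x).2) :
    (schubertPairs G).card = 2 * ((schubertPairs (F 0)).card + (schubertPairs (F 1)).card) := by
  zify
  rw [card_schubertPairs_eq_sum, card_schubertPairs_eq_sum, card_schubertPairs_eq_sum,
    ← e.symm.sum_comp]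
  simp only [fun i => (e.symm.sum_comp fun j => if i < j then ((if i ∈ G then 1 else 0) *
    (1 - if j ∈ G then 1 else 0) : ℤ) else 0).symm]
  rw [Fintype.sum_prod_type]
  simp only [Fintype.sum_prod_type, Fin.sum_univ_two, he, hG, Equiv.apply_symm_apply]
  set a : P → ℤ := fun i => if i ∈ F 0 then 1 else 0 with ha
  set b : P → ℤ := fun i => if i ∈ F 1 then 1 else 0 with hb
  have hd : ∑ i, (a i - b i) = 0 := by
    rw [Finset.sum_sub_distrib]
    simp [ha, hb, hF]
  have h1 := two_mul_sum_lt_eq fun i => a i - b i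
  rw [hd] at h1
  have h2 : ∑ i, (a i - b i) ^ 2 = ∑ i, 2 * (a i * (1 - b i)) := by
    rw [← sub_eq_zero, ← Finset.sum_sub_distrib, ← neg_eq_zero, ← Finset.sum_neg_distrib, ← hd]
    refine Finset.sum_congr rfl fun i _ => ?_
    simp only [ha, hb]
    split_ifs <;> norm_num
  rw [h2, ← Finset.mul_sum] at h1
  have h3 : ∑ i, a i * (1 - b i) = ∑ i, ∑ j, if i = j then a i * (1 - b j) else 0 := by simp
  rw [h3] at h1
  simp only [Finset.sum_add_distrib, lt_self_iff_false, and_false, or_false, Fin.zero_lt_one,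
    and_true, Fin.not_lt_zero, Fin.isValue]
  change (∑ i, ∑ j, if i < j then a i * (1 - a j) else 0) +
      (∑ i, ∑ j, if i < j ∨ i = j then a i * (1 - b j) else 0) +
      ((∑ i, ∑ j, if i < j then b i * (1 - a j) else 0) +
        ∑ i, ∑ j, if i < j then b i * (1 - b j) else 0) =
    2 * ((∑ i, ∑ j, if i < j then a i * (1 - a j) else 0) +
        ∑ i, ∑ j, if i < j then b i * (1 - b j) else 0)
  have h4 : (∑ i, ∑ j, if i < j ∨ i = j then a i * (1 - b j) else 0) +
      (∑ i, ∑ j, if i < j then b i * (1 - a j) else 0) =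
      (∑ i, ∑ j, if i < j then a i * (1 - a j) else 0) +
      (∑ i, ∑ j, if i < j then b i * (1 - b j) else 0) +
      (∑ i, ∑ j, if i < j then (a i - b i) * (a j - b j) else 0) +
      ∑ i, ∑ j, if i = j then a i * (1 - b j) else 0 := by
    simp only [← Finset.sum_add_distrib]
    refine Finset.sum_congr rfl fun i _ => Finset.sum_congr rfl fun j _ => ?_
    rcases lt_trichotomy i j with h | h | h
    · simp only [h, h.ne, if_true, if_false, or_false]
      ring
    · simp [h]
    · simp [h.not_gt, h.ne']
  linarith

end Doubling

section BlockFrame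

variable {N P o : Type*} [Fintype N] [DecidableEq N] [Fintype P] [DecidableEq P] [Fintype o]
  [DecidableEq o] (e₁ e₂ : N ≃ P × o) (k : o → Matrix P P ℝ)

lemma blockDiagonal_submatrix_transpose_mul_self (hk : ∀ r, (k r)ᵀ * k r = 1) :
    ((blockDiagonal k).submatrix e₁ e₂)ᵀ * (blockDiagonal k).submatrix e₁ e₂ = 1 := by
  rw [transpose_submatrix, submatrix_mul_equiv, blockDiagonal_transpose, ← blockDiagonal_mul]
  simp only [hk]
  rw [show (fun _ : o => (1 : Matrix P P ℝ)) = 1 from rfl, blockDiagonal_one, submatrix_one_equiv]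

lemma blockDiagonal_submatrix_mul_diagonal (l : o → P → ℝ) :
    (blockDiagonal k).submatrix e₁ e₂ * diagonal (fun x => l (e₂ x).2 (e₂ x).1) =
      (blockDiagonal fun r => k r * diagonal (l r)).submatrix e₁ e₂ := by
  rw [blockDiagonal_mul, blockDiagonal_diagonal, ← submatrix_mul_equiv _ _ e₁ e₂ e₂,
    submatrix_diagonal_equiv]
  rfl

lemma blockDiagonal_submatrix_mul_diagonal_mul_transpose (l : o → P → ℝ) :
    (blockDiagonal k).submatrix e₁ e₂ * diagonal (fun x => l (e₂ x).2 (e₂ x).1) *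
        ((blockDiagonal k).submatrix e₁ e₂)ᵀ =
      (blockDiagonal fun r => k r * diagonal (l r) * (k r)ᵀ).submatrix e₁ e₁ := by
  rw [blockDiagonal_submatrix_mul_diagonal, transpose_submatrix, submatrix_mul_equiv,
    blockDiagonal_transpose, ← blockDiagonal_mul]

end BlockFrame

section

variable {N P : Type*} [Fintype N] [LinearOrder N] [Fintype P] [LinearOrder P]

lemma card_filter_pos_eq (k : Fin 3 → Matrix P P ℝ) (hk : ∀ s, (k s)ᵀ * k s = 1)
    {M : Matrix P P ℝ} (hMs : Mᵀ = M) {μ : Fin 3 → P → ℝ}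
    (hMμ : ∀ t, M * k t = k t * diagonal (μ t)) {F : Fin 3 → Finset P}
    (hF : ∀ s i, i ∈ F s ↔ 0 < μ s i) (s t : Fin 3) : (F s).card = (F t).card := by
  have h1 := spectral_projection_mul (hk t) (hMμ t) (hMμ s) hMs fun x => if 0 < x then 1 else 0
  have h2 : ∀ t, (diagonal ((fun x : ℝ => if 0 < x then (1 : ℝ) else 0) ∘ μ t)).trace =
      (F t).card := by
    intro t
    simp [trace_diagonal, ← hF]
  have h3 : ∀ t (D : Matrix P P ℝ), (k t * D * (k t)ᵀ).trace = D.trace := by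
    intro t D
    rw [trace_mul_comm, ← mul_assoc, hk, one_mul]
  have h4 := congrArg (fun A => (A * (k s)ᵀ).trace) h1
  simp only [mul_assoc _ (k s) (k s)ᵀ, mul_eq_one_comm.mp (hk s), mul_one, h3] at h4
  exact_mod_cast (h2 s).symm.trans (h4.symm.trans (h2 t))

/-- A triple of frames in dimension `P`, doubled to dimension `2P`, yields an inequality between
the eigenvalues of any three matrices of size `2P` summing to zero, two of which are
isospectral. -/
theorem horn_inequality_of_doubled_eigenbasis (e : N ≃ P × Fin 2)
    (he : ∀ x y, x < y ↔ (e x).1 < (e y).1 ∨ (e x).1 = (e y).1 ∧ (e x).2 < (e y).2)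
    (k : Fin 3 → Matrix P P ℝ) (hk : ∀ s, (k s)ᵀ * k s = 1)
    (l : Fin 3 → P → ℝ) (hl₂ : Antitone (l 2))
    (hl : Antitone fun x => ![l 0, l 1] (e x).2 (e x).1)
    (M : Matrix P P ℝ) (hM : ∑ s, k s * diagonal (l s) * (k s)ᵀ = M) (μ : Fin 3 → P → ℝ)
    (hMμ : ∀ t, M * k t = k t * diagonal (μ t)) (F : Fin 3 → Finset P)
    (hF : ∀ s i, i ∈ F s ↔ 0 < μ s i)
    (hcount : ∀ t, ∑ s, (schubertPairs (F s)).card ≤ (F t).card * (F t)ᶜ.card)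
    (U₀ U₁ U₂ : Matrix N N ℝ) (hU₀ : U₀ᵀ * U₀ = 1) (hU₁ : U₁ᵀ * U₁ = 1) (hU₂ : U₂ᵀ * U₂ = 1)
    (α γ : N → ℝ) (hα : Antitone α) (hγ : Antitone γ)
    (hsum : U₀ * diagonal α * U₀ᵀ + U₁ * diagonal α * U₁ᵀ + U₂ * diagonal γ * U₂ᵀ = 0) :
    ∑ i ∈ F 0, α (e.symm (i, 0)) + ∑ i ∈ F 1, α (e.symm (i, 1)) +
      ∑ i ∈ F 2, (γ (e.symm (i, 0)) + γ (e.symm (i, 1))) / 2 ≤ 0 := by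
  have hMs : Mᵀ = M := by
    rw [← hM, transpose_sum]
    refine Finset.sum_congr rfl fun s _ => ?_
    simp only [transpose_mul, transpose_transpose, diagonal_transpose, mul_assoc]
  have hcard := card_filter_pos_eq k hk hMs hMμ hF
  set e' : N ≃ P × Fin 2 := e.trans ((Equiv.refl P).prodCongr (Equiv.swap 0 1)) with he'
  let k₂ : Fin 2 → Matrix P P ℝ := ![k 0, k 1]
  let F₂ : Fin 2 → Finset P := ![F 0, F 1]
  let μ₂ : Fin 2 → P → ℝ := ![μ 0, μ 1]
  let l₂ : Fin 2 → P → ℝ := ![l 0, l 1]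
  have hk₂ : ∀ r, (k₂ r)ᵀ * k₂ r = 1 := Fin.forall_fin_two.mpr ⟨hk 0, hk 1⟩
  have hMμ₂ : ∀ r, M * k₂ r = k₂ r * diagonal (μ₂ r) := Fin.forall_fin_two.mpr ⟨hMμ 0, hMμ 1⟩
  have hF₂ : ∀ r i, i ∈ F₂ r ↔ 0 < μ₂ r i := Fin.forall_fin_two.mpr ⟨hF 0, hF 1⟩
  let h₀ := (blockDiagonal k₂).submatrix e e
  let h₁ := (blockDiagonal k₂).submatrix e' e
  let h₂ := (blockDiagonal fun _ : Fin 2 => k 2).submatrix e e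
  let Mh := (blockDiagonal fun _ : Fin 2 => M).submatrix e e
  have hMh : Mh = (blockDiagonal fun _ : Fin 2 => M).submatrix e' e' := by
    ext x y
    simp [Mh, e', blockDiagonal_apply]
  let μ₀₁ : N → ℝ := fun x => μ₂ (e x).2 (e x).1
  let l₀₁ : N → ℝ := fun x => l₂ (e x).2 (e x).1
  let F₀₁ : Finset N := Finset.univ.filter fun x => (e x).1 ∈ F₂ (e x).2
  let F₂₂ : Finset N := Finset.univ.filter fun x => (e x).1 ∈ F 2
  have hF₀₁ : ∀ x, x ∈ F₀₁ ↔ (e x).1 ∈ F₂ (e x).2 := fun x => by simp [F₀₁]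
  have hF₂₂ : ∀ x, x ∈ F₂₂ ↔ (e x).1 ∈ (fun _ : Fin 2 => F 2) (e x).2 := fun x => by simp [F₂₂]
  have hmono : ∀ x y, x ≤ y → (e x).1 ≤ (e y).1 := by
    intro x y hxy
    rcases hxy.eq_or_lt with rfl | h
    · exact le_rfl
    · rcases (he x y).mp h with h | h
      · exact h.le
      · exact h.1.le
  have hsumh : ∑ s : Fin 3, ![h₀, h₁, h₂] s * diagonal ((![l₀₁, l₀₁, fun x => l 2 (e x).1] :
      Fin 3 → N → ℝ) s) * (![h₀, h₁, h₂] s)ᵀ = Mh := by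
    rw [Fin.sum_univ_three]
    change h₀ * diagonal l₀₁ * h₀ᵀ + h₁ * diagonal l₀₁ * h₁ᵀ +
      h₂ * diagonal (fun x => (fun _ : Fin 2 => l 2) (e x).2 (e x).1) * h₂ᵀ = Mh
    rw [blockDiagonal_submatrix_mul_diagonal_mul_transpose e e k₂ l₂,
      blockDiagonal_submatrix_mul_diagonal_mul_transpose e' e k₂ l₂,
      blockDiagonal_submatrix_mul_diagonal_mul_transpose e e (fun _ => k 2) fun _ => l 2]
    rw [Fin.sum_univ_three] at hM
    have h5 : ∀ r, k₂ r * diagonal (l₂ r) * (k₂ r)ᵀ + k₂ (Equiv.swap 0 1 r) *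
        diagonal (l₂ (Equiv.swap 0 1 r)) * (k₂ (Equiv.swap 0 1 r))ᵀ +
        k 2 * diagonal (l 2) * (k 2)ᵀ = M := by
      refine Fin.forall_fin_two.mpr ⟨?_, ?_⟩
      · rw [Equiv.swap_apply_left]; exact hM
      · rw [Equiv.swap_apply_right, add_comm (k₂ 1 * _ * _)]; exact hM
    ext x y
    simp only [Matrix.add_apply, submatrix_apply, blockDiagonal_apply, Mh, e', Equiv.trans_apply,
      Equiv.prodCongr_apply, Prod.map, Equiv.refl_apply, EmbeddingLike.apply_eq_iff_eq]
    split_ifs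
    · rw [← h5 (e x).2]; rfl
    · simp
  have hdouble := card_schubertPairs_doubling e he (F := F₂) (hcard 0 1) hF₀₁
  have hdouble₂ := card_schubertPairs_doubling e he (F := fun _ => F 2) rfl hF₂₂
  have hcardh : ∀ G : Fin 3 → Finset N, G = ![F₀₁, F₀₁, F₂₂] →
      ∑ s, (schubertPairs (G s)).card ≤ (G 0).card * (G 0)ᶜ.card := by
    rintro G rfl
    have h6 : F₀₁.card = 2 * (F 0).card := by
      have := sum_mem_eq_sum_fin_two e hF₀₁ fun _ => 1
      simp only [Finset.sum_const, smul_eq_mul, mul_one] at this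
      rw [this, two_mul]
      exact congrArg _ (hcard 1 0)
    have h7 : F₀₁ᶜ.card = 2 * (F 0)ᶜ.card := by
      have hN : Fintype.card N = Fintype.card P * 2 := by simp [Fintype.card_congr e]
      rw [Finset.card_compl, Finset.card_compl, h6, hN]
      omega
    have h8 := hcount 0
    rw [Fin.sum_univ_three] at h8 ⊢
    change (schubertPairs F₀₁).card + (schubertPairs F₀₁).card + (schubertPairs F₂₂).card ≤
      F₀₁.card * F₀₁ᶜ.card
    rw [h6, h7, hdouble, hdouble₂]
    change 2 * ((schubertPairs (F 0)).card + (schubertPairs (F 1)).card) +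
      2 * ((schubertPairs (F 0)).card + (schubertPairs (F 1)).card) +
      2 * ((schubertPairs (F 2)).card + (schubertPairs (F 2)).card) ≤ _
    nlinarith [h8]
  have key := horn_inequality_of_common_eigenbasis ![h₀, h₁, h₂]
    (Fin.forall_fin_succ.mpr ⟨blockDiagonal_submatrix_transpose_mul_self e e k₂ hk₂,
      Fin.forall_fin_two.mpr ⟨blockDiagonal_submatrix_transpose_mul_self e' e k₂ hk₂,
        blockDiagonal_submatrix_transpose_mul_self e e _ fun _ => hk 2⟩⟩)
    ![l₀₁, l₀₁, fun x => l 2 (e x).1] ![μ₀₁, μ₀₁, fun x => μ 2 (e x).1]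
    (Fin.forall_fin_succ.mpr ⟨hl, Fin.forall_fin_two.mpr ⟨hl, fun x y h => hl₂ (hmono x y h)⟩⟩)
    Mh hsumh
    (Fin.forall_fin_succ.mpr ⟨by
      change Mh * h₀ = h₀ * diagonal μ₀₁
      rw [blockDiagonal_submatrix_mul_diagonal e e k₂ μ₂, submatrix_mul_equiv, ← blockDiagonal_mul]
      simp only [hMμ₂], Fin.forall_fin_two.mpr ⟨by
      change Mh * h₁ = h₁ * diagonal μ₀₁
      rw [blockDiagonal_submatrix_mul_diagonal e' e k₂ μ₂, hMh, submatrix_mul_equiv,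
        ← blockDiagonal_mul]
      simp only [hMμ₂], by
      change Mh * h₂ = h₂ * diagonal fun x => (fun _ : Fin 2 => μ 2) (e x).2 (e x).1
      rw [blockDiagonal_submatrix_mul_diagonal e e (fun _ => k 2) fun _ => μ 2, submatrix_mul_equiv,
        ← blockDiagonal_mul]
      simp only [hMμ]⟩⟩)
    ![F₀₁, F₀₁, F₂₂]
    (Fin.forall_fin_succ.mpr ⟨fun x => (hF₀₁ x).trans (hF₂ _ _),
      Fin.forall_fin_two.mpr ⟨fun x => (hF₀₁ x).trans (hF₂ _ _),
        fun x => (hF₂₂ x).trans (hF 2 _)⟩⟩) 0 (hcardh _ rfl)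
    ![U₀, U₁, U₂] (Fin.forall_fin_succ.mpr ⟨hU₀, Fin.forall_fin_two.mpr ⟨hU₁, hU₂⟩⟩)
    ![α, α, γ] (Fin.forall_fin_succ.mpr ⟨hα, Fin.forall_fin_two.mpr ⟨hα, hγ⟩⟩)
    (by rw [Fin.sum_univ_three]; exact hsum)
  rw [Fin.sum_univ_three] at key
  change ∑ x ∈ F₀₁, α x + ∑ x ∈ F₀₁, α x + ∑ x ∈ F₂₂, γ x ≤ 0 at key
  rw [sum_mem_eq_sum_fin_two e hF₀₁, sum_mem_eq_sum_fin_two e (F := fun _ => F 2) hF₂₂] at key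
  change (∑ i ∈ F 0, α (e.symm (i, 0)) + ∑ i ∈ F 1, α (e.symm (i, 1))) +
    (∑ i ∈ F 0, α (e.symm (i, 0)) + ∑ i ∈ F 1, α (e.symm (i, 1))) +
    (∑ i ∈ F 2, γ (e.symm (i, 0)) + ∑ i ∈ F 2, γ (e.symm (i, 1))) ≤ 0 at key
  rw [← Finset.sum_div, Finset.sum_add_distrib]
  linarith

end

section

variable {P : Type*} [Fintype P]

lemma trace_conj_diagonal [DecidableEq P] {U : Matrix P P ℝ} (hU : Uᵀ * U = 1) (v : P → ℝ) :
    (U * diagonal v * Uᵀ).trace = ∑ i, v i := by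
  rw [trace_mul_comm, ← mul_assoc, hU, one_mul, trace_diagonal]

lemma trace_mul_self_le_of_sum_pos_le [DecidableEq P] {k M : Matrix P P ℝ} (hk : kᵀ * k = 1)
    {μ : P → ℝ} (hM : M * k = k * diagonal μ) {c : ℝ} (hpos : ∑ i with 0 < μ i, μ i ≤ c)
    (htr : -c ≤ ∑ i, μ i) : (M * M).trace ≤ (3 * c) ^ 2 := by
  have h1 : (M * M).trace = ∑ i, |μ i| ^ 2 := by
    have h2 : M * M = k * (diagonal μ * diagonal μ) * kᵀ := by
      calc M * M = M * (M * k) * kᵀ := by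
            rw [← mul_assoc, mul_assoc (M * M), mul_eq_one_comm.mp hk, mul_one]
        _ = _ := by rw [hM, ← mul_assoc, hM, mul_assoc k]
    rw [h2, trace_mul_comm, ← mul_assoc, hk, one_mul, diagonal_mul_diagonal, trace_diagonal]
    exact Finset.sum_congr rfl fun i _ => by rw [sq_abs, sq]
  have h3 : ∑ i, |μ i| = 2 * ∑ i with 0 < μ i, μ i - ∑ i, μ i := by
    rw [Finset.sum_filter, Finset.mul_sum, ← Finset.sum_sub_distrib]
    refine Finset.sum_congr rfl fun i _ => ?_
    split_ifs with h
    · rw [abs_of_pos h]; ring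
    · rw [abs_of_nonpos (not_lt.mp h)]; ring
  rw [h1]
  refine (Finset.sum_sq_le_sq_sum_of_nonneg fun i _ => abs_nonneg _).trans ?_
  exact pow_le_pow_left₀ (Finset.sum_nonneg fun i _ => abs_nonneg _) (by linarith) 2

lemma sum_pos_eigenvalues_eq {ι : Type*} [Fintype ι] [DecidableEq P] {k : ι → Matrix P P ℝ}
    (hk : ∀ s, (k s)ᵀ * k s = 1) {l : ι → P → ℝ} {M : Matrix P P ℝ}
    (hM : ∑ s, k s * diagonal (l s) * (k s)ᵀ = M) {μ : ι → P → ℝ}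
    (hMμ : ∀ t, M * k t = k t * diagonal (μ t)) {F : ι → Finset P}
    (hF : ∀ s i, i ∈ F s ↔ 0 < μ s i) (t : ι) :
    ∑ i ∈ F t, μ t i = ∑ s, ∑ i ∈ F s, l s i := by
  have hMs : Mᵀ = M := by
    rw [← hM, transpose_sum]
    refine Finset.sum_congr rfl fun s _ => ?_
    simp only [transpose_mul, transpose_transpose, diagonal_transpose, mul_assoc]
  obtain ⟨E, h1⟩ : ∃ E : Matrix P P ℝ, ∀ s,
      E * k s = k s * diagonal fun i => if 0 < μ s i then 1 else 0 :=
    ⟨_, fun s => spectral_projection_mul (hk t) (hMμ t) (hMμ s) hMs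
      fun x => if 0 < x then 1 else 0⟩
  have h2 : ∀ s (v : P → ℝ),
      (E * (k s * diagonal v * (k s)ᵀ)).trace = ∑ i ∈ F s, v i := by
    intro s v
    rw [mul_assoc (k s), ← mul_assoc, h1, mul_assoc, trace_mul_comm]
    simp only [mul_assoc]
    rw [hk, mul_one, diagonal_mul_diagonal, trace_diagonal]
    simp only [ite_mul, one_mul, zero_mul, ← hF]
    rw [Finset.sum_ite_mem, Finset.univ_inter]
  have h3 : M = k t * diagonal (μ t) * (k t)ᵀ := by
    rw [← hMμ, mul_assoc, mul_eq_one_comm.mp (hk t), mul_one]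
  rw [← h2, ← h3, ← hM, Finset.mul_sum, trace_sum]
  exact Finset.sum_congr rfl fun s _ => h2 s _

variable {N : Type*} [Fintype N] [LinearOrder N] [LinearOrder P]

/-- Averages, over pairs of consecutive entries, of the spectra of three matrices summing to
zero. -/
noncomputable def halvedSpectra (e : N ≃ P × Fin 2) (α γ : N → ℝ) : Fin 3 → P → ℝ :=
  ![fun i => α (e.symm (i, 0)), fun i => α (e.symm (i, 1)),
    fun i => (γ (e.symm (i, 0)) + γ (e.symm (i, 1))) / 2]

lemma exists_frames_trace_sq_le (e : N ≃ P × Fin 2)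
    (he : ∀ x y, x < y ↔ (e x).1 < (e y).1 ∨ (e x).1 = (e y).1 ∧ (e x).2 < (e y).2)
    (U₀ U₁ U₂ : Matrix N N ℝ) (hU₀ : U₀ᵀ * U₀ = 1) (hU₁ : U₁ᵀ * U₁ = 1) (hU₂ : U₂ᵀ * U₂ = 1)
    (α γ : N → ℝ) (hα : Antitone α) (hγ : Antitone γ)
    (hsum : U₀ * diagonal α * U₀ᵀ + U₁ * diagonal α * U₁ᵀ + U₂ * diagonal γ * U₂ᵀ = 0)
    (w : P → ℝ) (hw : StrictAnti w) {ε : ℝ} (hε : 0 < ε) :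
    ∃ k : Fin 3 → Matrix P P ℝ, (∀ s, (k s)ᵀ * k s = 1) ∧
      ((∑ s, k s * diagonal (fun i => halvedSpectra e α γ s i + ε * w i) * (k s)ᵀ) *
        ∑ s, k s * diagonal (fun i => halvedSpectra e α γ s i + ε * w i) * (k s)ᵀ).trace ≤
      (3 * (ε * (3 * ∑ i, |w i|))) ^ 2 := by
  have hmono : ∀ x y, x ≤ y → (e x).1 ≤ (e y).1 := by
    intro x y hxy
    rcases hxy.eq_or_lt with rfl | h
    · exact le_rfl
    · rcases (he x y).mp h with h | h
      · exact h.le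
      · exact h.1.le
  have hsymm : ∀ r : Fin 2, ∀ i j, i < j → e.symm (i, r) < e.symm (j, r) := by
    intro r i j hij
    rw [he]
    simp [hij]
  have hεw : StrictAnti fun i => ε * w i := fun i j hij => mul_lt_mul_of_pos_left (hw hij) hε
  have hanti : ∀ s, Antitone (halvedSpectra e α γ s) := by
    have h : ∀ v : N → ℝ, Antitone v → ∀ r : Fin 2, Antitone fun i => v (e.symm (i, r)) := by
      intro v hv r i j hij
      rcases hij.eq_or_lt with rfl | h
      · exact le_rfl
      · exact hv (hsymm r i j h).le
    refine Fin.forall_fin_succ.mpr ⟨h α hα 0, Fin.forall_fin_two.mpr ⟨h α hα 1, fun i j hij => ?_⟩⟩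
    have h0 := h γ hγ 0 hij
    have h1 := h γ hγ 1 hij
    change (_ + _) / 2 ≤ (_ + _) / 2
    simp only at h0 h1
    linarith
  set l : Fin 3 → P → ℝ := fun s i => halvedSpectra e α γ s i + ε * w i with hl
  have hlanti : ∀ s, StrictAnti (l s) := fun s i j hij =>
    add_lt_add_of_le_of_lt (hanti s hij.le) (hεw hij)
  obtain ⟨k, M, μ, hk, hM, hMμ, hcount⟩ := exists_common_eigenbasis l hlanti
  refine ⟨k, hk, ?_⟩
  rw [hM]
  let F : Fin 3 → Finset P := fun s => Finset.univ.filter fun i => 0 < μ s i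
  have hF : ∀ s i, i ∈ F s ↔ 0 < μ s i := fun s i => by simp [F]
  have horn := horn_inequality_of_doubled_eigenbasis e he k hk l (hlanti 2).antitone (by
    have h : (fun x => ![l 0, l 1] (e x).2 (e x).1) = fun x => α x + ε * w (e x).1 := by
      funext x
      obtain ⟨⟨i, r⟩, rfl⟩ := e.symm.surjective x
      rw [e.apply_symm_apply]
      revert r
      exact Fin.forall_fin_two.mpr ⟨rfl, rfl⟩
    rw [h]
    exact fun x y hxy => add_le_add (hα hxy) (hεw.antitone (hmono x y hxy))) M hM μ hMμ F hF
    (hcount F hF) U₀ U₁ U₂ hU₀ hU₁ hU₂ α γ hα hγ hsum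
  have hW : 0 ≤ ∑ i, |w i| := Finset.sum_nonneg fun i _ => abs_nonneg _
  refine trace_mul_self_le_of_sum_pos_le (hk 0) (hMμ 0) ?_ ?_
  · have h1 := sum_pos_eigenvalues_eq hk hM hMμ hF 0
    have h2 : ∀ s, ∑ i ∈ F s, l s i ≤ ∑ i ∈ F s, halvedSpectra e α γ s i + ε * ∑ i, |w i| := by
      intro s
      rw [hl, Finset.sum_add_distrib, ← Finset.mul_sum]
      gcongr
      exact (Finset.sum_le_sum fun i _ => le_abs_self _).trans
        (Finset.sum_le_sum_of_subset_of_nonneg (Finset.subset_univ _) fun i _ _ => abs_nonneg _)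
    change ∑ i ∈ F 0, μ 0 i ≤ _
    rw [h1, Fin.sum_univ_three]
    have h3 : ∑ i ∈ F 0, halvedSpectra e α γ 0 i + ∑ i ∈ F 1, halvedSpectra e α γ 1 i +
      ∑ i ∈ F 2, halvedSpectra e α γ 2 i ≤ 0 := horn
    linarith [h2 0, h2 1, h2 2]
  · have h1 : M.trace = ∑ i, μ 0 i := by
      rw [← trace_conj_diagonal (hk 0), ← hMμ, mul_assoc, mul_eq_one_comm.mp (hk 0), mul_one]
    have h2 : M.trace = ∑ s, ∑ i, l s i := by
      rw [← hM, trace_sum]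
      exact Finset.sum_congr rfl fun s _ => trace_conj_diagonal (hk s) _
    have h3 : ∑ x, α x + ∑ x, α x + ∑ x, γ x = 0 := by
      rw [← trace_conj_diagonal hU₀ α, ← trace_conj_diagonal hU₂ γ]
      nth_rewrite 2 [trace_conj_diagonal hU₀ α]
      rw [← trace_conj_diagonal hU₁ α, ← trace_add, ← trace_add, hsum, trace_zero]
    have h4 : ∀ v : N → ℝ, ∑ x, v x = ∑ i, v (e.symm (i, 0)) + ∑ i, v (e.symm (i, 1)) := by
      intro v
      rw [← e.symm.sum_comp, Fintype.sum_prod_type_right, Fin.sum_univ_two]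
    have h5 : ∑ s, ∑ i, halvedSpectra e α γ s i = 0 := by
      rw [Fin.sum_univ_three]
      change ∑ i, α (e.symm (i, 0)) + ∑ i, α (e.symm (i, 1)) +
        ∑ i, (γ (e.symm (i, 0)) + γ (e.symm (i, 1))) / 2 = 0
      rw [h4, h4] at h3
      rw [← Finset.sum_div, Finset.sum_add_distrib]
      linarith
    have h6 : -∑ i, |w i| ≤ ∑ i, w i := by
      rw [← Finset.sum_neg_distrib]
      exact Finset.sum_le_sum fun i _ => neg_abs_le _
    rw [← h1, h2]
    simp only [hl, Finset.sum_add_distrib, h5, zero_add, ← Finset.mul_sum, Finset.sum_const,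
      Finset.card_univ, Fintype.card_fin, nsmul_eq_mul]
    push_cast
    nlinarith [mul_le_mul_of_nonneg_left h6 hε.le]

lemma exists_frames_sum_eq_zero (e : N ≃ P × Fin 2)
    (he : ∀ x y, x < y ↔ (e x).1 < (e y).1 ∨ (e x).1 = (e y).1 ∧ (e x).2 < (e y).2)
    (U₀ U₁ U₂ : Matrix N N ℝ) (hU₀ : U₀ᵀ * U₀ = 1) (hU₁ : U₁ᵀ * U₁ = 1) (hU₂ : U₂ᵀ * U₂ = 1)
    (α γ : N → ℝ) (hα : Antitone α) (hγ : Antitone γ)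
    (hsum : U₀ * diagonal α * U₀ᵀ + U₁ * diagonal α * U₁ᵀ + U₂ * diagonal γ * U₂ᵀ = 0)
    (w : P → ℝ) (hw : StrictAnti w) :
    ∃ k : Fin 3 → Matrix P P ℝ, (∀ s, (k s)ᵀ * k s = 1) ∧
      ∑ s, k s * diagonal (halvedSpectra e α γ s) * (k s)ᵀ = 0 := by
  let S : (Fin 3 → Matrix P P ℝ) × ℝ → Matrix P P ℝ := fun x =>
    ∑ s, x.1 s * diagonal (fun i => halvedSpectra e α γ s i + x.2 * w i) * (x.1 s)ᵀ
  have hS : Continuous S := by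
    refine continuous_finsetSum _ fun s _ => ?_
    fun_prop
  let K : Set ((Fin 3 → Matrix P P ℝ) × ℝ) :=
    {k : Fin 3 → Matrix P P ℝ | ∀ s, (k s)ᵀ * k s = 1} ×ˢ Set.Icc 0 1
  have hK : IsCompact K := isCompact_setOf_orthogonal_families.prod isCompact_Icc
  let T := K ∩ {x | (S x * S x).trace ≤ (3 * (x.2 * (3 * ∑ i, |w i|))) ^ 2}
  have hT : IsCompact T := hK.inter_right (isClosed_le (by fun_prop) (by fun_prop))
  have hclosed : IsClosed (Prod.snd '' T) := (hT.image continuous_snd).isClosed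
  have hsub : Set.Ioc (0 : ℝ) 1 ⊆ Prod.snd '' T := by
    intro ε hε
    obtain ⟨k, hk, h⟩ := exists_frames_trace_sq_le e he U₀ U₁ U₂ hU₀ hU₁ hU₂ α γ hα hγ hsum w hw
      hε.1
    exact ⟨(k, ε), ⟨⟨hk, hε.1.le, hε.2⟩, h⟩, rfl⟩
  have h0 : (0 : ℝ) ∈ Prod.snd '' T := by
    refine hclosed.closure_subset_iff.mpr hsub ?_
    rw [closure_Ioc zero_ne_one]
    exact ⟨le_rfl, zero_le_one⟩
  obtain ⟨⟨k, ε⟩, ⟨⟨hk, -⟩, h⟩, rfl : ε = 0⟩ := h0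
  refine ⟨k, hk, ?_⟩
  have hSk : S (k, 0) = ∑ s, k s * diagonal (halvedSpectra e α γ s) * (k s)ᵀ := by
    simp only [S, zero_mul, add_zero]
  rw [← hSk]
  have hsym : (S (k, 0))ᵀ = S (k, 0) := by
    rw [hSk, transpose_sum]
    refine Finset.sum_congr rfl fun s _ => ?_
    simp only [transpose_mul, transpose_transpose, diagonal_transpose, mul_assoc]
  have h1 : (S (k, 0) * S (k, 0)).trace ≤ 0 := by
    simpa using h
  have h2 : 0 ≤ ((S (k, 0))ᵀ * S (k, 0)).trace := by
    simp only [trace, diag_apply, mul_apply, transpose_apply]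
    exact Finset.sum_nonneg fun i _ => Finset.sum_nonneg fun j _ => mul_self_nonneg _
  rw [hsym] at h2
  refine (Matrix.trace_conjTranspose_mul_self_eq_zero_iff (A := S (k, 0))).mp ?_
  rw [conjTranspose_eq_transpose_of_trivial, hsym]
  exact le_antisymm h1 h2

end

section

variable {N : Type*} [Fintype N] [DecidableEq N]

lemma exists_perm_of_map_univ_eq {α β γ : Type*} [Fintype α] [Fintype β] {f : α → γ} {g : β → γ}
    (h : Finset.univ.val.map f = Finset.univ.val.map g) : ∃ e : α ≃ β, ∀ a, g (e a) = f a := by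
  classical
  have h1 : ∀ c, Nonempty ({a // f a = c} ≃ {b // g b = c}) := by
    intro c
    rw [← Fintype.card_eq, Fintype.card_subtype, Fintype.card_subtype]
    have h2 := congrArg (Multiset.count c) h
    rw [Multiset.count_map, Multiset.count_map] at h2
    simp only [@eq_comm _ c] at h2
    exact h2
  exact ⟨Equiv.ofFiberEquiv fun c => (h1 c).some, Equiv.ofFiberEquiv_map _⟩

lemma charpoly_conj_diagonal {U : Matrix N N ℝ} (hU : Uᵀ * U = 1) (v : N → ℝ) :
    (U * diagonal v * Uᵀ).charpoly = ∏ i, (Polynomial.X - Polynomial.C (v i)) := by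
  rw [charpoly_mul_comm, ← mul_assoc, hU, one_mul, charpoly_diagonal]

lemma submatrix_perm_transpose_mul_self {U : Matrix N N ℝ} (hU : Uᵀ * U = 1) (e : N ≃ N) :
    (U.submatrix id e)ᵀ * U.submatrix id e = 1 := by
  rw [transpose_submatrix, ← submatrix_mul _ _ _ _ _ Function.bijective_id, hU,
    submatrix_one_equiv]

lemma submatrix_perm_mul_diagonal_mul_transpose (U : Matrix N N ℝ) (v : N → ℝ) (e : N ≃ N) :
    U.submatrix id e * diagonal (v ∘ e) * (U.submatrix id e)ᵀ = U * diagonal v * Uᵀ := by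
  rw [← submatrix_diagonal_equiv, submatrix_mul_equiv, transpose_submatrix, submatrix_mul_equiv,
    submatrix_id_id]

lemma exists_orthogonal_conj_diagonal {A : Matrix N N ℝ} (hA : A.IsSymm) {v : N → ℝ}
    (h : A.charpoly = ∏ i, (Polynomial.X - Polynomial.C (v i))) :
    ∃ U : Matrix N N ℝ, Uᵀ * U = 1 ∧ U * diagonal v * Uᵀ = A := by
  have hH : A.IsHermitian := by rw [IsHermitian, conjTranspose_eq_transpose_of_trivial, hA]
  have h1 : Finset.univ.val.map v = Finset.univ.val.map hH.eigenvalues := by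
    have h2 := hH.roots_charpoly_eq_eigenvalues
    have h3 : (∏ i, (Polynomial.X - Polynomial.C (v i))).roots = Finset.univ.val.map v := by
      rw [← Polynomial.roots_multiset_prod_X_sub_C (Finset.univ.val.map v), Multiset.map_map]
      rfl
    rw [← h3, ← h, h2]
    rfl
  obtain ⟨e, he⟩ := exists_perm_of_map_univ_eq h1
  set V : Matrix N N ℝ := (hH.eigenvectorUnitary : Matrix N N ℝ) with hV
  have hVV : Vᵀ * V = 1 := by
    have := (Matrix.mem_unitaryGroup_iff' (A := V)).mp hH.eigenvectorUnitary.2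
    rwa [star_eq_conjTranspose, conjTranspose_eq_transpose_of_trivial] at this
  refine ⟨V.submatrix id e, submatrix_perm_transpose_mul_self hVV e, ?_⟩
  rw [show v = hH.eigenvalues ∘ e from funext fun i => (he i).symm,
    submatrix_perm_mul_diagonal_mul_transpose]
  have := hH.spectral_theorem
  rw [Unitary.conjStarAlgAut_apply] at this
  conv_rhs => rw [this]
  rw [star_eq_conjTranspose, conjTranspose_eq_transpose_of_trivial]
  rfl

end

section

variable (p : ℕ)

/-- The order-preserving identification of `Fin (2 * p)` with `p` consecutive pairs. -/
def finTwoMulEquiv : Fin (2 * p) ≃ Fin p × Fin 2 :=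
  (finCongr (mul_comm 2 p)).trans finProdFinEquiv.symm

lemma finTwoMulEquiv_symm_val (x : Fin p × Fin 2) :
    ((finTwoMulEquiv p).symm x : ℕ) = 2 * x.1 + x.2 := by
  simp [finTwoMulEquiv, add_comm]

lemma finTwoMulEquiv_lt_iff (x y : Fin (2 * p)) : x < y ↔
    (finTwoMulEquiv p x).1 < (finTwoMulEquiv p y).1 ∨
      (finTwoMulEquiv p x).1 = (finTwoMulEquiv p y).1 ∧
        (finTwoMulEquiv p x).2 < (finTwoMulEquiv p y).2 := by
  obtain ⟨⟨i, r⟩, rfl⟩ := (finTwoMulEquiv p).symm.surjective x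
  obtain ⟨⟨j, q⟩, rfl⟩ := (finTwoMulEquiv p).symm.surjective y
  rw [Fin.lt_def, finTwoMulEquiv_symm_val, finTwoMulEquiv_symm_val]
  simp only [Equiv.apply_symm_apply, Fin.lt_def, Fin.ext_iff]
  omega

variable {p}

lemma finTwoMulEquiv_symm_zero (i : Fin p) (h : 2 * i.val < 2 * p) :
    (finTwoMulEquiv p).symm (i, 0) = ⟨2 * i.val, h⟩ :=
  Fin.ext (finTwoMulEquiv_symm_val p _)

lemma finTwoMulEquiv_symm_one (i : Fin p) (h : 2 * i.val + 1 < 2 * p) :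
    (finTwoMulEquiv p).symm (i, 1) = ⟨2 * i.val + 1, h⟩ :=
  Fin.ext (finTwoMulEquiv_symm_val p _)

lemma rev_finTwoMulEquiv_symm_zero (i : Fin p) :
    ((finTwoMulEquiv p).symm (i, 0)).rev = (finTwoMulEquiv p).symm (i.rev, 1) := by
  ext
  rw [Fin.val_rev, finTwoMulEquiv_symm_val, finTwoMulEquiv_symm_val, Fin.val_rev]
  have := i.isLt
  simp only [Fin.val_zero, Fin.val_one]
  omega

lemma rev_finTwoMulEquiv_symm_one (i : Fin p) :
    ((finTwoMulEquiv p).symm (i, 1)).rev = (finTwoMulEquiv p).symm (i.rev, 0) := by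
  ext
  rw [Fin.val_rev, finTwoMulEquiv_symm_val, finTwoMulEquiv_symm_val, Fin.val_rev]
  have := i.isLt
  simp only [Fin.val_zero, Fin.val_one]
  omega

lemma exists_sum_of_horn (σ γ : Fin (2 * p) → ℝ) (hσ : Antitone σ) (hγ : Antitone γ)
    {A B : Matrix (Fin (2 * p)) (Fin (2 * p)) ℝ} (hA : A.IsSymm) (hB : B.IsSymm)
    (hAσ : A.charpoly = ∏ i, (Polynomial.X - Polynomial.C (σ i)))
    (hBσ : B.charpoly = ∏ i, (Polynomial.X - Polynomial.C (σ i)))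
    (hABγ : (A + B).charpoly = ∏ i, (Polynomial.X - Polynomial.C (γ i))) :
    ∃ a b : Matrix (Fin p) (Fin p) ℝ, a.IsSymm ∧ b.IsSymm ∧
      a.charpoly = ∏ i, (Polynomial.X - Polynomial.C (σ ((finTwoMulEquiv p).symm (i, 0)))) ∧
      b.charpoly = ∏ i, (Polynomial.X - Polynomial.C (σ ((finTwoMulEquiv p).symm (i, 1)))) ∧
      (a + b).charpoly = ∏ i, (Polynomial.X - Polynomial.C
        ((γ ((finTwoMulEquiv p).symm (i, 0)) + γ ((finTwoMulEquiv p).symm (i, 1))) / 2)) := by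
  obtain ⟨U₀, hU₀, rfl⟩ := exists_orthogonal_conj_diagonal hA hAσ
  obtain ⟨U₁, hU₁, rfl⟩ := exists_orthogonal_conj_diagonal hB hBσ
  obtain ⟨W, hW, hWγ⟩ := exists_orthogonal_conj_diagonal (hA.add hB) hABγ
  set e := finTwoMulEquiv p
  have hanti : Antitone ((fun x => -γ x) ∘ Fin.revPerm) := fun x y hxy =>
    neg_le_neg (hγ (Fin.rev_le_rev.mpr hxy))
  obtain ⟨k, hk, hsum⟩ := exists_frames_sum_eq_zero e (finTwoMulEquiv_lt_iff p) U₀ U₁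
    (W.submatrix id Fin.revPerm) hU₀ hU₁ (submatrix_perm_transpose_mul_self hW _) σ _ hσ hanti (by
      rw [submatrix_perm_mul_diagonal_mul_transpose, ← hWγ]
      have : diagonal (fun x => -γ x) = -diagonal γ := (diagonal_neg γ).symm
      rw [this, mul_neg, neg_mul, add_neg_cancel]) (fun i : Fin p => -(i : ℝ))
    (fun i j hij => neg_lt_neg (by exact_mod_cast hij))
  rw [Fin.sum_univ_three] at hsum
  have hsymm : ∀ s v, (k s * diagonal v * (k s)ᵀ).IsSymm := fun s v => by
    rw [IsSymm]
    simp only [transpose_mul, transpose_transpose, diagonal_transpose, mul_assoc]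
  refine ⟨_, _, hsymm 0 _, hsymm 1 _, charpoly_conj_diagonal (hk 0) _,
    charpoly_conj_diagonal (hk 1) _, ?_⟩
  have h1 := eq_neg_of_add_eq_zero_left hsum
  change k 0 * diagonal (fun i => σ (e.symm (i, 0))) * (k 0)ᵀ +
    k 1 * diagonal (fun i => σ (e.symm (i, 1))) * (k 1)ᵀ = _ at h1
  rw [h1, ← neg_mul, ← mul_neg, diagonal_neg, charpoly_conj_diagonal (hk 2),
    ← Equiv.prod_comp Fin.revPerm]
  refine Finset.prod_congr rfl fun i _ => ?_
  congr 2
  change -((-γ (e.symm (i.rev, 0)).rev + -γ (e.symm (i.rev, 1)).rev) / 2) = _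
  rw [rev_finTwoMulEquiv_symm_zero, rev_finTwoMulEquiv_symm_one, Fin.rev_rev]
  ring

lemma exists_doubled_sum (σ : Fin (2 * p) → ℝ) (ν : Fin p → ℝ)
    {a b : Matrix (Fin p) (Fin p) ℝ} (ha : a.IsSymm) (hb : b.IsSymm)
    (haσ : a.charpoly = ∏ i, (Polynomial.X - Polynomial.C (σ ((finTwoMulEquiv p).symm (i, 0)))))
    (hbσ : b.charpoly = ∏ i, (Polynomial.X - Polynomial.C (σ ((finTwoMulEquiv p).symm (i, 1)))))
    (habν : (a + b).charpoly = ∏ i, (Polynomial.X - Polynomial.C (ν i))) :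
    ∃ A B : Matrix (Fin (2 * p)) (Fin (2 * p)) ℝ, A.IsSymm ∧ B.IsSymm ∧
      A.charpoly = ∏ i, (Polynomial.X - Polynomial.C (σ i)) ∧
      B.charpoly = ∏ i, (Polynomial.X - Polynomial.C (σ i)) ∧
      (A + B).charpoly = ∏ x, (Polynomial.X - Polynomial.C (ν (finTwoMulEquiv p x).1)) := by
  obtain ⟨U, hU, hUa⟩ := exists_orthogonal_conj_diagonal ha haσ
  obtain ⟨V, hV, hVb⟩ := exists_orthogonal_conj_diagonal hb hbσ
  obtain ⟨W, hW, hWab⟩ := exists_orthogonal_conj_diagonal (ha.add hb) habν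
  set e := finTwoMulEquiv p
  set e' := e.trans ((Equiv.refl (Fin p)).prodCongr (Equiv.swap 0 1)) with he'
  let k : Fin 2 → Matrix (Fin p) (Fin p) ℝ := ![U, V]
  let l : Fin 2 → Fin p → ℝ := fun r i => σ (e.symm (i, r))
  have hl : σ = fun x => l (e x).2 (e x).1 := by
    funext x
    simp [l]
  have hk : ∀ r, (k r)ᵀ * k r = 1 := Fin.forall_fin_two.mpr ⟨hU, hV⟩
  have hab : ∀ r, k r * diagonal (l r) * (k r)ᵀ = ![a, b] r := Fin.forall_fin_two.mpr ⟨hUa, hVb⟩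
  have hsymm : ∀ e : Fin (2 * p) ≃ Fin p × Fin 2,
      ((blockDiagonal ![a, b]).submatrix e e).IsSymm := by
    intro e
    rw [IsSymm, transpose_submatrix, blockDiagonal_transpose]
    congr 2
    exact funext (Fin.forall_fin_two.mpr ⟨ha, hb⟩)
  have hchar : ∀ e₁ : Fin (2 * p) ≃ Fin p × Fin 2,
      ((blockDiagonal ![a, b]).submatrix e₁ e₁).charpoly =
        ∏ i, (Polynomial.X - Polynomial.C (σ i)) := by
    intro e₁
    have h := blockDiagonal_submatrix_mul_diagonal_mul_transpose e₁ e k l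
    simp only [hab, ← hl] at h
    rw [← charpoly_conj_diagonal (blockDiagonal_submatrix_transpose_mul_self e₁ e k hk), h]
  refine ⟨_, _, hsymm e, hsymm e', hchar e, hchar e', ?_⟩
  have hsum : (blockDiagonal ![a, b]).submatrix e e + (blockDiagonal ![a, b]).submatrix e' e' =
      (blockDiagonal fun _ : Fin 2 => a + b).submatrix e e := by
    have h5 : ∀ r : Fin 2, ![a, b] r + ![a, b] (Equiv.swap 0 1 r) = a + b := by
      refine Fin.forall_fin_two.mpr ⟨?_, ?_⟩
      · rw [Equiv.swap_apply_left]; rfl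
      · rw [Equiv.swap_apply_right]; exact add_comm b a
    ext x y
    simp only [Matrix.add_apply, submatrix_apply, blockDiagonal_apply, he', Equiv.trans_apply,
      Equiv.prodCongr_apply, Prod.map, Equiv.refl_apply, EmbeddingLike.apply_eq_iff_eq]
    split_ifs
    · rw [← Matrix.add_apply (a), ← h5 (e x).2]; rfl
    · simp
  have h := blockDiagonal_submatrix_mul_diagonal_mul_transpose e e (fun _ => W) fun _ => ν
  simp only [hWab] at h
  rw [hsum, ← h,
    charpoly_conj_diagonal (blockDiagonal_submatrix_transpose_mul_self e e _ fun _ => hW)]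

end

/-- Corollary 2 of the paper: the orthogonal projection of the Horn
polytope `𝒫` onto the diagonal `Δ ≅ ℝ^p` equals `𝒫₁`. Given reals `σ₁ ≥ ⋯ ≥ σ_{2p}`,
the set of `p`-tuples `((γ̂₁+γ̂₂)/2, …, (γ̂_{2p-1}+γ̂_{2p})/2)`, where
`γ̂₁ ≥ ⋯ ≥ γ̂_{2p}` ranges over the ordered spectra of sums `A + B` of real symmetric
`2p × 2p` matrices each with ordered spectrum `σ`, coincides with the set `𝒫₁` of
ordered spectra of sums `a + b` of real symmetric `p × p` matrices with ordered
spectra `(σ₁, σ₃, …, σ_{2p-1})` and `(σ₂, σ₄, …, σ_{2p})` respectively. -/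
theorem projection_of_horn_polytope_eq_P1
    (p : ℕ) (hp : 1 ≤ p)
    (σ : Fin (2 * p) → ℝ) (hσ : Antitone σ) :
    {μ : Fin p → ℝ |
      ∃ γ : Fin (2 * p) → ℝ, Antitone γ ∧
        (∃ A B : Matrix (Fin (2 * p)) (Fin (2 * p)) ℝ, A.IsSymm ∧ B.IsSymm ∧
          A.charpoly = ∏ i : Fin (2 * p), (Polynomial.X - Polynomial.C (σ i)) ∧
          B.charpoly = ∏ i : Fin (2 * p), (Polynomial.X - Polynomial.C (σ i)) ∧
          (A + B).charpoly = ∏ i : Fin (2 * p), (Polynomial.X - Polynomial.C (γ i))) ∧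
        ∀ k : Fin p, μ k = (γ ⟨2 * k.val, by have := k.isLt; omega⟩ +
          γ ⟨2 * k.val + 1, by have := k.isLt; omega⟩) / 2} =
    {ν : Fin p → ℝ | Antitone ν ∧
      ∃ a b : Matrix (Fin p) (Fin p) ℝ, a.IsSymm ∧ b.IsSymm ∧
        a.charpoly = ∏ i : Fin p,
          (Polynomial.X - Polynomial.C (σ ⟨2 * i.val, by have := i.isLt; omega⟩)) ∧
        b.charpoly = ∏ i : Fin p,
          (Polynomial.X - Polynomial.C (σ ⟨2 * i.val + 1, by have := i.isLt; omega⟩)) ∧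
        (a + b).charpoly = ∏ i : Fin p, (Polynomial.X - Polynomial.C (ν i))} := by
  simp only [← finTwoMulEquiv_symm_zero, ← finTwoMulEquiv_symm_one]
  ext μ
  constructor
  · rintro ⟨γ, hγ, ⟨A, B, hA, hB, hAσ, hBσ, hAB⟩, hμ⟩
    obtain rfl : μ = _ := funext hμ
    refine ⟨fun i j hij => ?_, exists_sum_of_horn σ γ hσ hγ hA hB hAσ hBσ hAB⟩
    have h : ∀ r : Fin 2, γ ((finTwoMulEquiv p).symm (j, r)) ≤
        γ ((finTwoMulEquiv p).symm (i, r)) := by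
      intro r
      apply hγ
      rw [Fin.le_def, finTwoMulEquiv_symm_val, finTwoMulEquiv_symm_val]
      have : (i : ℕ) ≤ j := hij
      simp only
      omega
    linarith [h 0, h 1]
  · rintro ⟨hμ, a, b, ha, hb, haσ, hbσ, hab⟩
    refine ⟨fun x => μ (finTwoMulEquiv p x).1, fun x y hxy => hμ ?_,
      exists_doubled_sum σ μ ha hb haσ hbσ hab, fun k => by simp⟩
    rcases hxy.eq_or_lt with rfl | h
    · exact le_rfl
    · rcases (finTwoMulEquiv_lt_iff p x y).mp h with h | h
      · exact h.le
      · exact h.1.le
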